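/- arXiv:hep-th/9605123 — 6 statements merged into one kernel-verified Lean document; each statement's English description precedes it below -/
import Mathlib

section
/- Triangularity of the special basis: let α = (α_1,…,α_N) and ε = (ε_1,…,ε_N) be multi-indices in {1,…,n}^N, where each value i occurs exactly m times in α, and define the order α > ε iff there is k ≥ 0 with α_i = ε_i for 1 ≤ i ≤ k and α_{k+1} > ε_{k+1}. If α < ε then the component w_α^{ε_1⋯ε_N}(z_1,…,z_N) of the vector w_α(z_1,…,z_N) vanishes identically. -/
noncomputable section

/-- Entries of the trigonometric R-matrix of the vector representation of
`U_q(sl_n^)`: the row index is `(ε₁, ε₂)`, the column index is `(ε'₁, ε'₂)`. -/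
def Rent (n : ℕ) (q z : ℂ) (r c : Fin n × Fin n) : ℂ :=
  if r = c then (if r.1 = r.2 then 1 else (1 - z) * q / (1 - z * q ^ 2))
  else if r.1 = c.2 ∧ r.2 = c.1 then
    (if r.1 < r.2 then (1 - q ^ 2) * z / (1 - z * q ^ 2) else (1 - q ^ 2) / (1 - z * q ^ 2))
  else 0

/-- `R_{ab}(z)` acting on `V^{⊗N}`. -/
def Rop (n : ℕ) (q : ℂ) (N : ℕ) (a b : Fin N) (z : ℂ) :
    Matrix (Fin N → Fin n) (Fin N → Fin n) ℂ :=
  Matrix.of fun ε ε' => Rent n q z (ε a, ε b) (ε' a, ε' b) *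
    ∏ i ∈ Finset.univ.filter (fun i => i ≠ a ∧ i ≠ b), (if ε i = ε' i then (1 : ℂ) else 0)

/-- The operator `R_{1,N+1}(z₁/t) ⋯ R_{N,N+1}(z_N/t)` on `V^{⊗(N+1)}`. -/
def BigR (n : ℕ) (q : ℂ) (N : ℕ) (z : Fin N → ℂ) (t : ℂ) :
    Matrix (Fin (N + 1) → Fin n) (Fin (N + 1) → Fin n) ℂ :=
  ((List.finRange N).map (fun (j : Fin N) =>
    Rop n q (N + 1) j.castSucc (Fin.last N) (z j / t))).prod

/-- The quantum monodromy operator `T_{εε'}(z₁,…,z_N | t) ∈ End(V^{⊗N})`: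
the `(ε, ε')` block of `BigR` with respect to the basis of the last factor. -/
def Tmat (n : ℕ) (q : ℂ) (N : ℕ) (z : Fin N → ℂ) (t : ℂ) (e e' : Fin n) :
    Matrix (Fin N → Fin n) (Fin N → Fin n) ℂ :=
  Matrix.of fun a b => BigR n q N z t (Fin.snoc a e) (Fin.snoc b e')

/-- The vacuum vector `Ω = v₁ ⊗ ⋯ ⊗ v₁`. -/
def Omega (n N : ℕ) : (Fin N → Fin n) → ℂ :=
  fun ε => if ∀ j, (ε j : ℕ) = 0 then 1 else 0

/-- The special basis vector
`w_α = Π_l T_{1n}(z|z_l^{(n)}) ⋯ Π_l T_{12}(z|z_l^{(2)}) Ω`, where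
`z_1^{(i)}, …, z_m^{(i)}` is the subsequence of the `z_j` at positions `j`
with `α_j = i` (values in `Fin n`, i.e. `v_i ↔ i - 1`). -/
def wvec (n : ℕ) (hn : 0 < n) (q : ℂ) (N : ℕ) (α : Fin N → Fin n) (z : Fin N → ℂ) :
    (Fin N → Fin n) → ℂ :=
  (((((List.finRange n).reverse.dropLast)).map (fun c =>
      ((List.finRange N).filter (fun j => α j = c)).map
        (fun j => Tmat n q N z (z j) ⟨0, hn⟩ c))).flatten).prod.mulVec (Omega n N)


/-! ### Local actions -/

namespace TriAux

/-- off-diagonal coefficient -/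
def oc {n : ℕ} (q z : ℂ) (x y : Fin n) : ℂ :=
  if x < y then (1 - q ^ 2) * z / (1 - z * q ^ 2) else (1 - q ^ 2) / (1 - z * q ^ 2)

/-- diagonal coefficient -/
def dc (q z : ℂ) : ℂ := (1 - z) * q / (1 - z * q ^ 2)

/-- two-variable kernel -/
def kern {n : ℕ} (q z : ℂ) (x y : Fin n) (u v : ℂ) : ℂ :=
  if x = y then u else dc q z * u + oc q z x y * v

theorem ybe {n : ℕ} (q a b t : ℂ) (ha : a ≠ 0) (hb : b ≠ 0) (ht : t ≠ 0)
    (h1 : 1 - a / b * q ^ 2 ≠ 0) (h2 : 1 - a / t * q ^ 2 ≠ 0) (h3 : 1 - b / t * q ^ 2 ≠ 0)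
    (G : Fin n → Fin n → Fin n → ℂ) (x y w : Fin n)
    (r12 r13 r23 : (Fin n → Fin n → Fin n → ℂ) → (Fin n → Fin n → Fin n → ℂ))
    (e12 : r12 = fun G x y w => kern q (a / b) x y (G x y w) (G y x w))
    (e13 : r13 = fun G x y w => kern q (a / t) x w (G x y w) (G w y x))
    (e23 : r23 = fun G x y w => kern q (b / t) y w (G x y w) (G x w y)) :
    r12 (r13 (r23 G)) x y w = r23 (r13 (r12 G)) x y w := by
  have h1' : b - a * q ^ 2 ≠ 0 := by
    intro h; apply h1; field_simp; simpa using h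
  have h2' : t - a * q ^ 2 ≠ 0 := by
    intro h; apply h2; field_simp; simpa using h
  have h3' : t - b * q ^ 2 ≠ 0 := by
    intro h; apply h3; field_simp; simpa using h
  have k1 : 1 - a / b * q ^ 2 = (b - a * q ^ 2) / b := by field_simp
  have k2 : 1 - a / t * q ^ 2 = (t - a * q ^ 2) / t := by field_simp
  have k3 : 1 - b / t * q ^ 2 = (t - b * q ^ 2) / t := by field_simp
  subst e12 e13 e23
  simp only [kern, oc, dc, k1, k2, k3]
  rcases lt_trichotomy x y with h | h | h <;> rcases lt_trichotomy y w with h' | h' | h' <;>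
    rcases lt_trichotomy x w with h'' | h'' | h'' <;>
    first
    | (exfalso; omega)
    | (subst_vars
       have h4' : t - q ^ 2 * b ≠ 0 := by rwa [mul_comm]
       simp [*, ne_of_lt, ne_of_gt, not_lt_of_gt]
       try (field_simp; ring))

variable {n N : ℕ}

/-- `R_{ij}` on functions -/
def act (q z : ℂ) (i j : Fin N) (v : (Fin N → Fin n) → ℂ) : (Fin N → Fin n) → ℂ :=
  fun ε => kern q z (ε i) (ε j) (v ε)
    (v (Function.update (Function.update ε i (ε j)) j (ε i)))

/-- `R_{j,aux}` on functions -/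
def aux (q z : ℂ) (j : Fin N) (F : (Fin N → Fin n) → Fin n → ℂ) :
    (Fin N → Fin n) → Fin n → ℂ :=
  fun ε e => kern q z (ε j) e (F ε e) (F (Function.update ε j e) (ε j))

/-- `R_{ij}` acting trivially on the auxiliary factor -/
def actx (q z : ℂ) (i j : Fin N) (F : (Fin N → Fin n) → Fin n → ℂ) :
    (Fin N → Fin n) → Fin n → ℂ :=
  fun ε e => act q z i j (fun ε => F ε e) ε

theorem ybe_op (q a b t : ℂ) (ha : a ≠ 0) (hb : b ≠ 0) (ht : t ≠ 0)
    (h1 : 1 - a / b * q ^ 2 ≠ 0) (h2 : 1 - a / t * q ^ 2 ≠ 0) (h3 : 1 - b / t * q ^ 2 ≠ 0)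
    (i j : Fin N) (hij : i ≠ j) (F : (Fin N → Fin n) → Fin n → ℂ) :
    actx q (a / b) i j (aux q (a / t) i (aux q (b / t) j F)) =
      aux q (b / t) j (aux q (a / t) i (actx q (a / b) i j F)) := by
  funext ε e
  have key := ybe q a b t ha hb ht h1 h2 h3
    (fun x y w => F (Function.update (Function.update ε i x) j y) w) (ε i) (ε j) e _ _ _ rfl rfl rfl
  have hji := hij.symm
  have c1 : ∀ x y x', Function.update (Function.update (Function.update ε i x) j y) i x' =
      Function.update (Function.update ε i x') j y := by
    intro x y x'
    rw [Function.update_comm hji, Function.update_idem]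
  have L : ∀ (H : (Fin N → Fin n) → Fin n → ℂ) e, H ε e =
      (fun x y w => H (Function.update (Function.update ε i x) j y) w) (ε i) (ε j) e := by
    intro H e; simp
  rw [L (actx _ _ _ _ _), L (aux _ _ _ _)]
  simp only [actx, act, aux, Function.update_self, Function.update_of_ne hij, 
    Function.update_idem, c1]
  exact key

theorem comm_op (q z z' : ℂ) (i j k : Fin N) (hij : i ≠ j) (hki : k ≠ i) (hkj : k ≠ j)
    (F : (Fin N → Fin n) → Fin n → ℂ) :
    actx q z i j (aux q z' k F) = aux q z' k (actx q z i j F) := by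
  funext ε e
  have c1 : Function.update (Function.update (Function.update ε i (ε j)) j (ε i)) k e =
      Function.update (Function.update (Function.update ε k e) i (ε j)) j (ε i) := by
    rw [Function.update_comm hkj.symm, Function.update_comm hki.symm]
  simp only [actx, act, aux, Function.update_self, Function.update_of_ne hij, c1,
    Function.update_of_ne hki, Function.update_of_ne hkj, Function.update_of_ne hki.symm,
    Function.update_of_ne hkj.symm]
  unfold kern
  split_ifs <;> ring

/-- ordered product of `R_{j,aux}` -/
def fold (q : ℂ) (z : Fin N → ℂ) (t : ℂ) (l : List (Fin N))
    (F : (Fin N → Fin n) → Fin n → ℂ) : (Fin N → Fin n) → Fin n → ℂ :=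
  l.foldr (fun j F => aux q (z j / t) j F) F

theorem fold_append (q : ℂ) (z : Fin N → ℂ) (t : ℂ) (l l' : List (Fin N))
    (F : (Fin N → Fin n) → Fin n → ℂ) :
    fold q z t (l ++ l') F = fold q z t l (fold q z t l' F) := by
  simp [fold]

theorem fold_comm (q : ℂ) (z : Fin N → ℂ) (t z' : ℂ) (i j : Fin N) (hij : i ≠ j)
    (l : List (Fin N)) (hi : i ∉ l) (hj : j ∉ l) (F : (Fin N → Fin n) → Fin n → ℂ) :
    actx q z' i j (fold q z t l F) = fold q z t l (actx q z' i j F) := by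
  induction l with
  | nil => rfl
  | cons k l ih =>
    simp only [List.mem_cons, not_or] at hi hj
    have := ih hi.2 hj.2
    simp only [fold, List.foldr_cons] at this ⊢
    rw [comm_op _ _ _ _ _ _ hij (Ne.symm hi.1) (Ne.symm hj.1), this]

/-- Standing genericity hypotheses. -/
def Good (q : ℂ) (z : Fin N → ℂ) : Prop :=
  (∀ j, z j ≠ 0) ∧ ∀ i j : Fin N, 1 - (z i / z j) * q ^ 2 ≠ 0

theorem fold_swap (q : ℂ) (z : Fin N → ℂ) (hg : Good q z) (p : Fin N)
    (l1 l2 : List (Fin N)) (i j : Fin N) (hnd : (l1 ++ i :: j :: l2).Nodup)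
    (F : (Fin N → Fin n) → Fin n → ℂ) :
    actx q (z i / z j) i j (fold q z (z p) (l1 ++ i :: j :: l2) F) =
      fold q z (z p) (l1 ++ j :: i :: l2) (actx q (z i / z j) i j F) := by
  have hnd' := hnd
  simp only [List.nodup_append, List.nodup_cons, List.mem_cons, not_or] at hnd'
  obtain ⟨-, ⟨⟨hij, hi2⟩, hj2, -⟩, h⟩ := hnd'
  have hi1 : i ∉ l1 := fun hh => h i hh i (Or.inl rfl) rfl
  have hj1 : j ∉ l1 := fun hh => h j hh j (Or.inr (Or.inl rfl)) rfl
  rw [fold_append, fold_append, fold_comm q z (z p) _ i j hij l1 hi1 hj1]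
  congr 1
  have := fold_comm q z (z p) (z i / z j) i j hij l2 hi2 hj2 F
  simp only [fold, List.foldr_cons] at this ⊢
  rw [ybe_op q (z i) (z j) (z p) (hg.1 _) (hg.1 _) (hg.1 _) (hg.2 _ _) (hg.2 _ _) (hg.2 _ _) i j hij,
    this]

/-- monodromy operator on functions -/
def Tf (q : ℂ) (z : Fin N → ℂ) (t : ℂ) (l : List (Fin N)) (e e' : Fin n)
    (v : (Fin N → Fin n) → ℂ) : (Fin N → Fin n) → ℂ :=
  fun ε => fold q z t l (fun ε x => if x = e' then v ε else 0) ε e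

/-- the vector for ordering `l` of the sites and list `J` of applied sites -/
def W (q : ℂ) (z : Fin N → ℂ) (α : Fin N → Fin n) (e0 : Fin n) (l J : List (Fin N)) :
    (Fin N → Fin n) → ℂ :=
  J.foldr (fun j v => Tf q z (z j) l e0 (α j) v) (Omega n N)

theorem act_Omega (q z' : ℂ) (i j : Fin N) (hij : i ≠ j) :
    act q z' i j (Omega n N) = Omega n N := by
  funext ε
  unfold act kern
  split_ifs with h
  · rfl
  · have h1 : Omega n N ε = 0 := by
      unfold Omega
      rw [if_neg]
      intro hh
      exact h (Fin.ext ((hh i).trans (hh j).symm))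
    have h2 : Omega n N (Function.update (Function.update ε i (ε j)) j (ε i)) = 0 := by
      unfold Omega
      rw [if_neg]
      intro hh
      have a := hh i
      have b := hh j
      rw [Function.update_of_ne hij, Function.update_self] at a
      rw [Function.update_self] at b
      exact h (Fin.ext (b.trans a.symm))
    rw [h1, h2]; ring

theorem act_W (q : ℂ) (z : Fin N → ℂ) (hg : Good q z) (α : Fin N → Fin n) (e0 : Fin n)
    (l1 l2 : List (Fin N)) (i j : Fin N) (hnd : (l1 ++ i :: j :: l2).Nodup) (J : List (Fin N)) :
    act q (z i / z j) i j (W q z α e0 (l1 ++ i :: j :: l2) J) =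
      W q z α e0 (l1 ++ j :: i :: l2) J := by
  have hij : i ≠ j := by
    simp only [List.nodup_append, List.nodup_cons, List.mem_cons, not_or] at hnd
    exact hnd.2.1.1.1
  induction J with
  | nil => exact act_Omega _ _ _ _ hij
  | cons p J ih =>
    funext ε
    simp only [W, List.foldr_cons] at ih ⊢
    rw [← ih]
    have := congrFun (congrFun (fold_swap q z hg p l1 l2 i j hnd
      (fun ε x => if x = α p then W q z α e0 (l1 ++ i :: j :: l2) J ε else 0)) ε) e0
    simp only [Tf]
    refine Eq.trans this ?_
    congr 1
    congr 1
    funext ε x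
    simp only [actx, act]
    by_cases hx : x = α p
    · simp only [hx, if_true]; rfl
    · simp only [hx, if_false]; simp [kern]

/-- iterated `R_{k,j}` -/
def afold (q : ℂ) (z : Fin N → ℂ) (j : Fin N) (l : List (Fin N))
    (v : (Fin N → Fin n) → ℂ) : (Fin N → Fin n) → ℂ :=
  l.foldr (fun k v => act q (z k / z j) k j v) v

theorem afold_W (q : ℂ) (z : Fin N → ℂ) (hg : Good q z) (α : Fin N → Fin n) (e0 : Fin n)
    (j : Fin N) (J l0 l1 l2 : List (Fin N)) (hnd : (l1 ++ l0 ++ j :: l2).Nodup) :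
    afold q z j l0 (W q z α e0 (l1 ++ l0 ++ j :: l2) J) =
      W q z α e0 (l1 ++ j :: l0 ++ l2) J := by
  induction l0 generalizing l1 with
  | nil => simp [afold]
  | cons k l0 ih =>
    have h := ih (l1 ++ [k]) (by simpa using hnd)
    simp only [afold, List.foldr_cons] at h ⊢
    have e1 : l1 ++ k :: l0 ++ j :: l2 = l1 ++ [k] ++ l0 ++ j :: l2 := by simp
    rw [e1, h]
    have e2 : l1 ++ [k] ++ j :: l0 ++ l2 = l1 ++ k :: j :: (l0 ++ l2) := by simp
    rw [e2, act_W q z hg]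
    · simp
    · refine (List.Perm.nodup_iff ?_).1 hnd
      simp only [List.append_assoc, List.cons_append]
      refine List.Perm.append_left _ (List.Perm.cons _ ?_)
      exact List.perm_middle

theorem fold_last (q : ℂ) (z : Fin N → ℂ) (j : Fin N) (l0 : List (Fin N)) (hj : j ∉ l0)
    (c : Fin n) (v : (Fin N → Fin n) → ℂ) :
    fold q z (z j) l0 (fun ε e => if ε j = c then v (Function.update ε j e) else 0) =
      fun ε e => if ε j = c then afold q z j l0 v (Function.update ε j e) else 0 := by
  induction l0 with
  | nil => rfl
  | cons k l0 ih =>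
    simp only [List.mem_cons, not_or] at hj
    have h := ih hj.2
    have hjk := hj.1
    have hkj := Ne.symm hjk
    simp only [fold, afold, List.foldr_cons] at h ⊢
    rw [h]
    funext ε e
    simp only [aux, act, Function.update_self, Function.update_of_ne hjk,
      Function.update_of_ne hkj]
    by_cases hc : ε j = c
    · simp only [hc, if_true]
      rw [Function.update_comm hjk, Function.update_idem]
    · simp [hc, kern]

theorem aux_one (q : ℂ) (hq : 1 - q ^ 2 ≠ 0) (j : Fin N) (F : (Fin N → Fin n) → Fin n → ℂ) :
    aux q 1 j F = fun ε e => F (Function.update ε j e) (ε j) := by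
  funext ε e
  unfold aux kern dc oc
  split_ifs with h
  · subst h; simp
  · simp [hq]
  · simp [hq]

theorem Tf_last (q : ℂ) (z : Fin N → ℂ) (hg : Good q z) (j : Fin N) (l0 : List (Fin N))
    (hj : j ∉ l0) (e0 c : Fin n) (v : (Fin N → Fin n) → ℂ) (ε : Fin N → Fin n) :
    Tf q z (z j) (l0 ++ [j]) e0 c v ε =
      if ε j = c then afold q z j l0 v (Function.update ε j e0) else 0 := by
  unfold Tf
  rw [fold_append]
  have h := hg.2 j j
  have hz : z j / z j = 1 := div_self (hg.1 j)
  rw [hz, one_mul] at h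
  have : fold q z (z j) [j] (fun ε x => if x = c then v ε else 0) =
      fun ε e => if ε j = c then v (Function.update ε j e) else 0 := by
    simp only [fold, List.foldr_cons, List.foldr_nil, hz]
    rw [aux_one q h]
  rw [this, fold_last q z j l0 hj]

/-! ### Dominance -/

/-- Dominance of `ε` by `α` along the ordering `l`. -/
def Dom (l : List (Fin N)) (α ε : Fin N → Fin n) : Prop :=
  ∀ (k : ℕ) (c : Fin n), (l.take k).countP (fun i => c ≤ ε i) ≤ (l.take k).countP (fun i => c ≤ α i)

theorem countP_upd (l : List (Fin N)) (j : Fin N) (hj : j ∉ l) (ε : Fin N → Fin n) (x c : Fin n) :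
    l.countP (fun i => c ≤ Function.update ε j x i) = l.countP (fun i => c ≤ ε i) := by
  apply List.countP_congr
  intro i hi
  have : i ≠ j := fun h => hj (h ▸ hi)
  simp [Function.update_of_ne this]

theorem Dom_iff (l : List (Fin N)) (α ε : Fin N → Fin n) :
    Dom l α ε ↔ ∀ l1 l2, l = l1 ++ l2 → ∀ c : Fin n,
      l1.countP (fun i => c ≤ ε i) ≤ l1.countP (fun i => c ≤ α i) := by
  constructor
  · rintro h l1 l2 rfl c
    simpa using h l1.length c
  · intro h k c
    exact h _ _ (List.take_append_drop k l).symm c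

theorem Dom_swap (l1 l2 : List (Fin N)) (i j : Fin N) (hnd : (l1 ++ i :: j :: l2).Nodup)
    (α ε : Fin N → Fin n) (hα : α i ≤ α j)
    (h : Dom (l1 ++ i :: j :: l2) α ε ∨ Dom (l1 ++ i :: j :: l2) α
      (Function.update (Function.update ε i (ε j)) j (ε i))) :
    Dom (l1 ++ j :: i :: l2) α ε := by
  simp only [List.nodup_append, List.nodup_cons, List.mem_cons, not_or] at hnd
  obtain ⟨-, ⟨⟨hij, hi2⟩, hj2, -⟩, h'⟩ := hnd
  have hi1 : i ∉ l1 := fun hh => h' i hh i (Or.inl rfl) rfl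
  have hj1 : j ∉ l1 := fun hh => h' j hh j (Or.inr (Or.inl rfl)) rfl
  -- consequences common to both cases
  have A : ∀ a b, l1 = a ++ b → ∀ c : Fin n,
      a.countP (fun i => c ≤ ε i) ≤ a.countP (fun i => c ≤ α i) := by
    rintro a b rfl c
    simp only [List.mem_append, not_or] at hi1 hj1
    rcases h with h | h <;> have h := (Dom_iff _ _ _).1 h a (b ++ i :: j :: l2) (by simp) c
    · exact h
    · rwa [countP_upd _ _ hj1.1, countP_upd _ _ hi1.1] at h
  have B : ∀ a b, l2 = a ++ b → ∀ c : Fin n,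
      (l1 ++ j :: i :: a).countP (fun i => c ≤ ε i) ≤
        (l1 ++ j :: i :: a).countP (fun i => c ≤ α i) := by
    rintro a b rfl c
    simp only [List.mem_append, not_or] at hi2 hj2
    rcases h with h | h <;> have h := (Dom_iff _ _ _).1 h (l1 ++ i :: j :: a) b (by simp) c
    · simp only [List.countP_append, List.countP_cons] at h ⊢
      omega
    · simp only [List.countP_append, List.countP_cons] at h ⊢
      rw [countP_upd _ _ hj1, countP_upd _ _ hi1, countP_upd _ _ hj2.1, countP_upd _ _ hi2.1] at h
      simp only [Function.update_self, Function.update_of_ne hij] at h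
      omega
  rw [Dom_iff]
  intro a b hab c
  rcases List.append_eq_append_iff.1 hab with ⟨s, hs, hs'⟩ | ⟨s, hs, hs'⟩
  · rcases s with _ | ⟨x, _ | ⟨y, s⟩⟩
    · subst hs
      simpa using A l1 [] (by simp) c
    · simp only [List.cons_append, List.nil_append, List.cons.injEq] at hs'
      obtain ⟨rfl, -⟩ := hs'
      subst hs
      have a1 := A l1 [] (by simp) c
      have b1 := B [] l2 (by simp) c
      simp only [List.countP_append, List.countP_cons, List.countP_nil] at b1 ⊢
      have : c ≤ α i → c ≤ α j := fun h => h.trans hα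
      simp only [decide_eq_true_eq] at b1 ⊢
      split_ifs at b1 ⊢ <;> first | omega | (exfalso; tauto)
    · simp only [List.cons_append, List.cons.injEq] at hs'
      obtain ⟨rfl, rfl, hs'⟩ := hs'
      subst hs
      exact B s b hs' c
  · exact A a s hs c

theorem W_move_step (q : ℂ) (z : Fin N → ℂ) (hg : Good q z) (α β : Fin N → Fin n) (e0 : Fin n)
    (J l1 l2 : List (Fin N)) (i j : Fin N) (hnd : (l1 ++ i :: j :: l2).Nodup)
    (hβ : β i ≤ β j)
    (h : ∀ ε, W q z α e0 (l1 ++ i :: j :: l2) J ε ≠ 0 → Dom (l1 ++ i :: j :: l2) β ε) :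
    ∀ ε, W q z α e0 (l1 ++ j :: i :: l2) J ε ≠ 0 → Dom (l1 ++ j :: i :: l2) β ε := by
  intro ε hε
  rw [← act_W q z hg α e0 l1 l2 i j hnd] at hε
  apply Dom_swap l1 l2 i j hnd β ε hβ
  by_contra hcon
  push Not at hcon
  apply hε
  have a := not_imp_not.2 (h ε) hcon.1
  have b := not_imp_not.2 (h _) hcon.2
  simp only [ne_eq, not_not] at a b
  unfold act
  rw [a, b]
  simp [kern]

theorem W_move (q : ℂ) (z : Fin N → ℂ) (hg : Good q z) (α β : Fin N → Fin n) (e0 : Fin n)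
    (J l2 l1 : List (Fin N)) (j : Fin N) (hnd : (l1 ++ l2 ++ [j]).Nodup)
    (hβ : ∀ i, β i ≤ β j)
    (h : ∀ ε, W q z α e0 (l1 ++ l2 ++ [j]) J ε ≠ 0 → Dom (l1 ++ l2 ++ [j]) β ε) :
    ∀ ε, W q z α e0 (l1 ++ j :: l2) J ε ≠ 0 → Dom (l1 ++ j :: l2) β ε := by
  induction l2 generalizing l1 with
  | nil => simpa using h
  | cons k l2 ih =>
    have h1 := ih (l1 ++ [k]) (by simpa using hnd) (by simpa using h)
    refine W_move_step q z hg α β e0 J l1 l2 k j ?_ (hβ k) (by simpa using h1)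
    refine (List.Perm.nodup_iff ?_).1 hnd
    simp only [List.append_assoc, List.cons_append]
    refine List.Perm.append_left _ (List.Perm.cons _ ?_)
    exact List.perm_append_singleton _ _

/-- colouring restricted to `J` -/
def res (α : Fin N → Fin n) (e0 : Fin n) (J : List (Fin N)) : Fin N → Fin n :=
  fun i => if i ∈ J then α i else e0

theorem W_dom (q : ℂ) (z : Fin N → ℂ) (hg : Good q z) (α : Fin N → Fin n) (e0 : Fin n)
    (he0 : ∀ x, e0 ≤ x) (he0' : (e0 : ℕ) = 0)
    (J : List (Fin N)) (hJ : J.Nodup) (hJ' : J.Pairwise (fun a b => α b ≤ α a)) :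
    ∀ l : List (Fin N), l.Nodup → (∀ i, i ∈ l) → ∀ ε, W q z α e0 l J ε ≠ 0 →
      Dom l (res α e0 J) ε := by
  induction J with
  | nil =>
    intro l _ _ ε hε
    have : ε = res α e0 [] := by
      simp only [W, List.foldr_nil, Omega] at hε
      funext i
      by_contra hne
      apply hε
      rw [if_neg]
      intro hh
      exact hne (Fin.ext (by simp [res, hh i, he0']))
    rw [this]
    intro k c
    exact le_rfl
  | cons j J ih =>
    rw [List.nodup_cons] at hJ
    rw [List.pairwise_cons] at hJ'
    have IH := ih hJ.2 hJ'.2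
    intro l hl hmem
    obtain ⟨l1, l2, rfl⟩ := List.append_of_mem (hmem j)
    have hperm : (l1 ++ j :: l2).Perm (l1 ++ l2 ++ [j]) := by
      rw [List.append_assoc]
      exact List.Perm.append_left _ (List.perm_append_singleton _ _).symm
    have hnd := hperm.nodup_iff.1 hl
    have hres : res α e0 (j :: J) j = α j := by simp [res]
    refine W_move q z hg α _ e0 (j :: J) l2 l1 j hnd ?_ ?_
    · intro i
      rw [hres]
      unfold res
      split_ifs with hi
      · rcases List.mem_cons.1 hi with rfl | hi
        · exact le_rfl
        · exact hJ'.1 i hi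
      · exact he0 _
    · generalize hl0 : l1 ++ l2 = l0 at *
      intro ε hε
      have hj0 : j ∉ l0 := by
        intro hh
        rw [List.nodup_append] at hnd
        exact hnd.2.2 j hh j (by simp) rfl
      simp only [W, List.foldr_cons] at hε
      rw [Tf_last q z hg j l0 hj0] at hε
      have hc : ε j = α j := by
        by_contra hcon
        rw [if_neg hcon] at hε
        exact hε rfl
      rw [if_pos hc] at hε
      have hA := afold_W q z hg α e0 j J l0 [] [] (by simpa using hnd)
      simp only [List.nil_append, List.append_nil] at hA
      have hε' : W q z α e0 (j :: l0) J (Function.update ε j e0) ≠ 0 := by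
        rw [← hA]; exact hε
      have hp2 : (l0 ++ [j]).Perm (j :: l0) := List.perm_append_singleton _ _
      have hD := IH (j :: l0) (hp2.nodup_iff.1 hnd)
        (fun i => hp2.mem_iff.1 (hperm.mem_iff.1 (hmem i))) _ hε'
      have hresJ : res α e0 J j = e0 := by simp [res, hJ.1]
      have hrr : res α e0 J = Function.update (res α e0 (j :: J)) j e0 := by
        funext i
        by_cases hi : i = j
        · subst hi; simp [hresJ]
        · simp [res, hi]
      have key : ∀ k (c : Fin n), (l0.take k).countP (fun i => c ≤ ε i) ≤
          (l0.take k).countP (fun i => c ≤ res α e0 (j :: J) i) := by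
        intro k c
        have hjk : j ∉ l0.take k := fun hh => hj0 (List.mem_of_mem_take hh)
        have := hD (k + 1) c
        rw [List.take_succ_cons, hrr] at this
        simp only [List.countP_cons, Function.update_self] at this
        rw [countP_upd _ _ hjk, countP_upd _ _ hjk] at this
        omega
      intro k c
      rw [List.take_append]
      have h1 := key k c
      simp only [List.countP_append]
      refine Nat.add_le_add h1 ?_
      apply le_of_eq
      apply List.countP_congr
      intro i hi
      have : i = j := by simpa using List.mem_of_mem_take hi
      subst this
      rw [hres, hc]

/-! ### Linking with the matrices -/

theorem Rop_mulVec (q z' : ℂ) (M : ℕ) (a b : Fin M) (hab : a ≠ b) (v : (Fin M → Fin n) → ℂ) :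
    (Rop n q M a b z').mulVec v = act q z' a b v := by
  funext ε
  have hP : ∀ ε' : Fin M → Fin n,
      (∏ i ∈ Finset.univ.filter (fun i => i ≠ a ∧ i ≠ b), (if ε i = ε' i then (1 : ℂ) else 0)) =
      if ∀ i, i ≠ a → i ≠ b → ε i = ε' i then 1 else 0 := by
    intro ε'
    rw [Finset.prod_ite_zero]
    simp
  set ε2 := Function.update (Function.update ε a (ε b)) b (ε a) with hε2
  have e2a : ε2 a = ε b := by simp [hε2, Function.update_of_ne hab]
  have e2b : ε2 b = ε a := by simp [hε2]
  have e2o : ∀ i, i ≠ a → i ≠ b → ε i = ε2 i := by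
    intro i h1 h2; simp [hε2, Function.update_of_ne h1, Function.update_of_ne h2]
  have z0 : ∀ ε', ε' ≠ ε → ε' ≠ ε2 → Rop n q M a b z' ε ε' = 0 := by
    intro ε' h1 h2
    simp only [Rop, Matrix.of_apply, hP]
    by_cases hh : ∀ i, i ≠ a → i ≠ b → ε i = ε' i
    · have n1 : ¬ ((ε a, ε b) = (ε' a, ε' b)) := by
        intro h
        simp only [Prod.mk.injEq] at h
        apply h1
        funext i
        by_cases ia : i = a
        · rw [ia, h.1]
        by_cases ib : i = b
        · rw [ib, h.2]
        exact (hh i ia ib).symm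
      have n2 : ¬ (ε a = ε' b ∧ ε b = ε' a) := by
        intro h
        apply h2
        funext i
        by_cases ia : i = a
        · rw [ia, e2a, h.2]
        by_cases ib : i = b
        · rw [ib, e2b, h.1]
        rw [← hh i ia ib, e2o i ia ib]
      simp only [Rent, if_neg n1, if_neg n2, zero_mul]
    · rw [if_neg hh, mul_zero]
  simp only [Matrix.mulVec, dotProduct, act, kern, ← hε2]
  by_cases hε : ε a = ε b
  · have he : ε2 = ε := by
      funext i
      by_cases ia : i = a
      · rw [ia, e2a, hε]
      by_cases ib : i = b
      · rw [ib, e2b, hε]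
      exact (e2o i ia ib).symm
    rw [Finset.sum_eq_single ε]
    · simp [Rop, hP, Rent, hε]
    · intro ε' _ h1
      rw [z0 ε' h1 (by rwa [he]), zero_mul]
    · simp
  · have hne : ε ≠ ε2 := by
      intro h
      exact hε (by rw [← e2a, ← h])
    rw [← Finset.sum_subset (Finset.subset_univ {ε, ε2}), Finset.sum_pair hne]
    · have hne' : ¬ (ε b = ε a) := fun h => hε h.symm
      simp only [Rop, Matrix.of_apply, hP, Rent, e2a, e2b, dc, oc, if_neg hε, if_pos e2o]
      simp [hε]
    · intro ε' _ h
      simp only [Finset.mem_insert, Finset.mem_singleton, not_or] at h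
      rw [z0 ε' h.1 h.2, zero_mul]

theorem act_snoc (q z' : ℂ) (j : Fin N) (F : (Fin (N + 1) → Fin n) → ℂ) :
    (fun ε e => act q z' j.castSucc (Fin.last N) F (Fin.snoc ε e : Fin (N + 1) → Fin n)) =
      aux q z' j (fun ε e => F (Fin.snoc ε e : Fin (N + 1) → Fin n)) := by
  funext ε e
  simp only [act, aux, Fin.snoc_castSucc, Fin.snoc_last]
  congr 2
  funext i
  refine Fin.lastCases ?_ (fun i => ?_) i
  · simp
  · have : i.castSucc ≠ Fin.last N := (Fin.castSucc_lt_last i).ne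
    rw [Function.update_of_ne this, Fin.snoc_castSucc]
    by_cases h : i = j
    · subst h; simp
    · rw [Function.update_of_ne h, Function.update_of_ne, Fin.snoc_castSucc]
      simpa using h

theorem BigR_mulVec (q : ℂ) (z : Fin N → ℂ) (t : ℂ) (l : List (Fin N))
    (F : (Fin (N + 1) → Fin n) → ℂ) :
    (fun ε e => ((l.map (fun (j : Fin N) =>
      Rop n q (N + 1) j.castSucc (Fin.last N) (z j / t))).prod.mulVec F)
        (Fin.snoc ε e : Fin (N + 1) → Fin n)) =
      fold q z t l (fun ε e => F (Fin.snoc ε e : Fin (N + 1) → Fin n)) := by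
  induction l with
  | nil => simp [fold]
  | cons j l ih =>
    simp only [List.map_cons, List.prod_cons, ← Matrix.mulVec_mulVec, fold, List.foldr_cons] at ih ⊢
    rw [Rop_mulVec _ _ _ _ _ (Fin.castSucc_lt_last j).ne, act_snoc, ih]

theorem Tmat_mulVec (q : ℂ) (z : Fin N → ℂ) (t : ℂ) (e e' : Fin n) (v : (Fin N → Fin n) → ℂ) :
    (Tmat n q N z t e e').mulVec v = Tf q z t (List.finRange N) e e' v := by
  funext ε
  have h := congrFun (congrFun (BigR_mulVec q z t (List.finRange N)
    (fun f => if f (Fin.last N) = e' then v (Fin.init f) else 0)) ε) e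
  simp only [Fin.snoc_last, Fin.init_snoc] at h
  unfold Tf
  rw [← h]
  simp only [Matrix.mulVec, dotProduct, Tmat, Matrix.of_apply, BigR]
  rw [← (Fin.snocEquiv (fun _ : Fin (N + 1) => Fin n)).sum_comp, Fintype.sum_prod_type]
  rw [Finset.sum_eq_single e']
  · simp [Fin.snocEquiv]
  · intro b _ hb
    simp [Fin.snocEquiv, hb]
  · simp

theorem prod_W (q : ℂ) (z : Fin N → ℂ) (α : Fin N → Fin n) (e0 : Fin n) (J : List (Fin N)) :
    ((J.map (fun j => Tmat n q N z (z j) e0 (α j))).prod).mulVec (Omega n N) =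
      W q z α e0 (List.finRange N) J := by
  induction J with
  | nil => simp [W]
  | cons j J ih =>
    simp only [List.map_cons, List.prod_cons, ← Matrix.mulVec_mulVec, W, List.foldr_cons] at ih ⊢
    rw [ih, Tmat_mulVec]

/-- the sites in the order of the definition of `wvec` -/
def sites (α : Fin N → Fin n) : List (Fin N) :=
  ((List.finRange n).reverse.dropLast).flatMap
    (fun c => (List.finRange N).filter (fun j => α j = c))

theorem wvec_eq (hn : 0 < n) (q : ℂ) (z : Fin N → ℂ) (α : Fin N → Fin n) :
    wvec n hn q N α z = W q z α ⟨0, hn⟩ (List.finRange N) (sites α) := by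
  rw [← prod_W]
  unfold wvec sites
  rw [List.map_flatMap, ← List.flatMap_def]
  congr 3
  funext c
  apply List.map_congr_left
  intro j hj
  have : α j = c := by simpa using hj
  rw [this]

theorem colors_gt : ((List.finRange n).reverse.dropLast).Pairwise (fun a b => b < a) := by
  refine List.Pairwise.sublist (List.dropLast_sublist _) ?_
  rw [List.pairwise_reverse]
  exact List.pairwise_lt_finRange n

theorem sites_nodup (α : Fin N → Fin n) : (sites α).Nodup := by
  unfold sites List.Nodup
  rw [List.pairwise_flatMap]
  refine ⟨fun c _ => (List.nodup_finRange N).filter _, ?_⟩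
  refine (colors_gt (n := n)).imp ?_
  intro a b hab x hx y hy hxy
  simp only [List.mem_filter, decide_eq_true_eq] at hx hy
  subst hxy
  rw [hx.2] at hy
  exact absurd hy.2 hab.ne'

theorem sites_pairwise (α : Fin N → Fin n) : (sites α).Pairwise (fun a b => α b ≤ α a) := by
  unfold sites
  rw [List.pairwise_flatMap]
  constructor
  · intro c _
    rw [List.pairwise_filter]
    refine List.pairwise_of_forall ?_
    intro a b ha hb
    simp only [decide_eq_true_eq] at ha hb
    rw [ha, hb]
  · refine (colors_gt (n := n)).imp ?_
    intro a b hab x hx y hy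
    simp only [List.mem_filter, decide_eq_true_eq] at hx hy
    rw [hx.2, hy.2]
    exact hab.le

theorem res_sites (hn : 0 < n) (α : Fin N → Fin n) : res α ⟨0, hn⟩ (sites α) = α := by
  funext i
  unfold res
  split_ifs with h
  · rfl
  · by_contra hne
    apply h
    unfold sites
    rw [List.mem_flatMap]
    refine ⟨α i, ?_, by simp⟩
    obtain ⟨k, rfl⟩ : ∃ k, n = k + 1 := ⟨n - 1, by omega⟩
    rw [List.finRange_succ, List.reverse_cons, List.dropLast_concat, List.mem_reverse, List.mem_map]
    have hne' : α i ≠ 0 := fun h => hne h.symm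
    obtain ⟨y, hy⟩ := Fin.exists_succ_eq.2 hne'
    exact ⟨y, by simp, hy⟩

end TriAux

/-- triangularity of the special basis: if `α < ε` in the
lexicographic order, then the component `w_α^{ε}(z₁,…,z_N)` vanishes. -/
theorem triangularity (n m N : ℕ) (hn : 2 ≤ n) (hm : 1 ≤ m) (hN : N = m * n)
    (q : ℂ) (hq : q ≠ 0) (z : Fin N → ℂ) (hz : ∀ j, z j ≠ 0)
    (hden : ∀ i j : Fin N, 1 - (z i / z j) * q ^ 2 ≠ 0)
    (α ε : Fin N → Fin n)
    (hα : ∀ c : Fin n, (Finset.univ.filter (fun j => α j = c)).card = m)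
    (hlt : ∃ k : Fin N, (∀ i : Fin N, i < k → α i = ε i) ∧ α k < ε k) :
    wvec n (by omega) q N α z ε = 0 := by
  have hn0 : 0 < n := by omega
  by_contra hne
  obtain ⟨k, hk, hlt⟩ := hlt
  have hD := TriAux.W_dom q z ⟨hz, hden⟩ α ⟨0, hn0⟩ (fun x => Fin.mk_le_of_le_val (Nat.zero_le _)) rfl
    (TriAux.sites α) (TriAux.sites_nodup α) (TriAux.sites_pairwise α) (List.finRange N)
    (List.nodup_finRange N) (fun i => List.mem_finRange i) ε (by
      rw [← TriAux.wvec_eq]; exact hne)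
  rw [TriAux.res_sites] at hD
  have h := hD (k + 1) (ε k)
  have hlen : (k : ℕ) < (List.finRange N).length := by simp
  rw [List.take_succ_eq_append_getElem hlen] at h
  simp only [List.countP_append, List.countP_cons, List.countP_nil, List.getElem_finRange] at h
  have hc : ((List.finRange N).take k).countP (fun i => ε k ≤ ε i) =
      ((List.finRange N).take k).countP (fun i => ε k ≤ α i) := by
    apply List.countP_congr
    intro i hi
    have hik : i < k := by
      obtain ⟨m', hm', rfl⟩ := List.mem_iff_getElem.1 hi
      simp only [List.length_take, List.length_finRange] at hm'
      simp only [List.getElem_take, List.getElem_finRange]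
      rw [Fin.lt_def]
      simp
      omega
    rw [hk i hik]
  rw [hc] at h
  have : ¬ (ε k ≤ α k) := not_le.2 hlt
  simp [this] at h
end
end

section
/- Linear dependence of the columns of the deformed matrix: for n ≥ 3, Σ_{λ=0}^{n−3} (z_1 τ^{2n−1})^λ Ã_{n−2−λ}(x | z_1, z_1τ^{2n−2}, z_3, …, z_n) = 0 identically in x, z_1, z_3, …, z_n (wherever the denominators are nonzero). -/
noncomputable section

/-- The `k`-th elementary symmetric polynomial `σ_k(z₁,…,z_N)`. -/
def esymF {N : ℕ} (z : Fin N → ℂ) (k : ℕ) : ℂ :=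
  ∑ s ∈ Finset.powersetCard k (Finset.univ : Finset (Fin N)), ∏ i ∈ s, z i

/-- `A_λ(x | z₁,…,z_n) = Σ_{κ=0}^{λ} (-1)^κ x^{λ-κ} (τ^{n(λ-κ)+κ} - τ^{-n(λ-κ)-κ}) σ_κ(z)`,
with `τ = q⁻¹`. -/
def Acl (q : ℂ) (n lam : ℕ) (x : ℂ) (z : Fin n → ℂ) : ℂ :=
  ∑ κ ∈ Finset.range (lam + 1),
    (-1 : ℂ) ^ κ * x ^ (lam - κ) *
      ((q⁻¹) ^ (n * (lam - κ) + κ) - q ^ (n * (lam - κ) + κ)) * esymF z κ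

/-- The function `g(x | z₁ | z₂, …, z_n)` (with `τ = q⁻¹`). -/
def gcl (q : ℂ) (n : ℕ) (hn : 0 < n) (x : ℂ) (z : Fin n → ℂ) : ℂ :=
  z ⟨0, hn⟩ * (q⁻¹) ^ (n + 1) / x *
    (q ^ 2 * ∏ j ∈ Finset.univ.filter (fun j : Fin n => 0 < (j : ℕ)),
        (x * (q⁻¹) ^ (n - 1) - z j) / (z ⟨0, hn⟩ * (q⁻¹) ^ 2 - z j)
      - (x - z ⟨0, hn⟩ * (q⁻¹) ^ (n - 1)) / (x - z ⟨0, hn⟩ * (q⁻¹) ^ (n + 1)) *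
        ∏ j ∈ Finset.univ.filter (fun j : Fin n => 0 < (j : ℕ)),
          (x * q ^ (n - 1) - z j) / (z ⟨0, hn⟩ * (q⁻¹) ^ 2 - z j))

/-- The deformed entries
`Ã_λ(x | z₁, …, z_n) = ((x - z₁τ^{n-1})/(x - z₁τ^{n+1})) A_λ(x | z₁τ^{2n}, z₂, …, z_n)
  + g(x|z₁|z₂,…,z_n) A_λ(z₁τ^{n+1} | z₁τ^{2n}, z₂, …, z_n)`. -/
def Atl (q : ℂ) (n : ℕ) (hn : 0 < n) (lam : ℕ) (x : ℂ) (z : Fin n → ℂ) : ℂ :=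
  (x - z ⟨0, hn⟩ * (q⁻¹) ^ (n - 1)) / (x - z ⟨0, hn⟩ * (q⁻¹) ^ (n + 1)) *
      Acl q n lam x (Function.update z ⟨0, hn⟩ (z ⟨0, hn⟩ * (q⁻¹) ^ (2 * n)))
    + gcl q n hn x z *
      Acl q n lam (z ⟨0, hn⟩ * (q⁻¹) ^ (n + 1))
        (Function.update z ⟨0, hn⟩ (z ⟨0, hn⟩ * (q⁻¹) ^ (2 * n)))

open Polynomial in
/-- Coefficient of `t^m` in `Q(t)/(1 - y t)`. -/
def TT (Q : ℂ[X]) (y : ℂ) (m : ℕ) : ℂ :=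
  ∑ κ ∈ Finset.range (m + 1), Q.coeff κ * y ^ (m - κ)

open Polynomial in
lemma TT_zero (Q : ℂ[X]) (y : ℂ) : TT Q y 0 = Q.coeff 0 := by simp [TT]

open Polynomial in
lemma TT_succ (Q : ℂ[X]) (y : ℂ) (m : ℕ) :
    TT Q y (m + 1) = y * TT Q y m + Q.coeff (m + 1) := by
  unfold TT
  rw [Finset.sum_range_succ, Finset.mul_sum]
  congr 1
  · refine Finset.sum_congr rfl fun κ hκ => ?_
    have h : m + 1 - κ = (m - κ) + 1 := by
      have := Finset.mem_range.1 hκ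
      omega
    rw [h, pow_succ]; ring
  · simp

open Polynomial in
lemma coeff_lin_zero (Q : ℂ[X]) (u : ℂ) : ((1 - C u * X) * Q).coeff 0 = Q.coeff 0 := by
  simp [mul_coeff_zero]

open Polynomial in
lemma coeff_lin_succ (Q : ℂ[X]) (u : ℂ) (m : ℕ) :
    ((1 - C u * X) * Q).coeff (m + 1) = Q.coeff (m + 1) - u * Q.coeff m := by
  rw [sub_mul, one_mul, coeff_sub, mul_assoc, coeff_C_mul, coeff_X_mul]

open Polynomial in
lemma TT_lin (Q : ℂ[X]) (u y : ℂ) (m : ℕ) :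
    TT ((1 - C u * X) * Q) y (m + 1) = TT Q y (m + 1) - u * TT Q y m := by
  induction m with
  | zero => rw [TT_succ, TT_succ, TT_zero, TT_zero, coeff_lin_zero, coeff_lin_succ]; ring
  | succ m ih =>
    rw [TT_succ, ih, coeff_lin_succ, TT_succ Q y (m + 1), TT_succ Q y m]; ring

open Polynomial in
lemma TT_tel (Q : ℂ[X]) (c y : ℂ) (N : ℕ) :
    ∑ l ∈ Finset.range (N + 1), c ^ l * TT ((1 - C c * X) * Q) y (N - l) = TT Q y N := by
  induction N with
  | zero => simp [TT_zero, mul_coeff_zero]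
  | succ N ih =>
    rw [Finset.sum_range_succ']
    have : ∑ l ∈ Finset.range (N + 1), c ^ (l + 1) * TT ((1 - C c * X) * Q) y (N + 1 - (l + 1))
        = c * TT Q y N := by
      rw [← ih, Finset.mul_sum]
      refine Finset.sum_congr rfl fun l _ => ?_
      rw [Nat.add_sub_add_right, pow_succ]; ring
    rw [this]
    simp only [pow_zero, one_mul, Nat.sub_zero]
    rw [TT_lin]; ring

open Polynomial in
lemma TT_prod {ι : Type*} [DecidableEq ι] (s : Finset ι) (u : ι → ℂ) :
    (∀ m, s.card < m → (∏ i ∈ s, (1 - C (u i) * X)).coeff m = 0) ∧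
    ∀ y, TT (∏ i ∈ s, (1 - C (u i) * X)) y s.card = ∏ i ∈ s, (y - u i) := by
  induction s using Finset.induction_on with
  | empty =>
    refine ⟨fun m hm => ?_, fun y => by simp [TT_zero]⟩
    simp only [Finset.card_empty] at hm
    simp [coeff_one, hm.ne']
  | insert a s ha ih =>
    obtain ⟨h1, h2⟩ := ih
    refine ⟨fun m hm => ?_, fun y => ?_⟩
    · rw [Finset.card_insert_of_notMem ha] at hm
      rw [Finset.prod_insert ha]
      obtain ⟨m, rfl⟩ : ∃ k, m = k + 1 := ⟨m - 1, by omega⟩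
      rw [coeff_lin_succ, h1 _ (by omega), h1 _ (by omega)]; ring
    · rw [Finset.card_insert_of_notMem ha, Finset.prod_insert ha, Finset.prod_insert ha, TT_lin,
        TT_succ, h1 _ (by omega), h2]
      ring

open Polynomial in
lemma coeff_top {ι : Type*} [DecidableEq ι] (s : Finset ι) (u : ι → ℂ) :
    (∏ i ∈ s, (1 - C (u i) * X)).coeff s.card = ∏ i ∈ s, (0 - u i) := by
  rw [← (TT_prod s u).2 0]
  cases s.card with
  | zero => rw [TT_zero]
  | succ m => rw [TT_succ]; ring

open Polynomial in
lemma TT_sub {ι : Type*} [DecidableEq ι] (s : Finset ι) (u : ι → ℂ) (y : ℂ) (N : ℕ)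
    (h : s.card = N + 1) :
    y * TT (∏ i ∈ s, (1 - C (u i) * X)) y N = ∏ i ∈ s, (y - u i) - ∏ i ∈ s, (0 - u i) := by
  rw [← (TT_prod s u).2 y, ← coeff_top, h, TT_succ]; ring

open Polynomial in
lemma coeff_esym {n : ℕ} (w : Fin n → ℂ) (t : ℂ) (k : ℕ) :
    (∏ i, (1 - C (t * w i) * X)).coeff k = (-1) ^ k * t ^ k * esymF w k := by
  have h : ∀ i, (1 - C (t * w i) * X : ℂ[X]) = 1 + C (-(t * w i)) * X := by
    intro i; rw [C_neg]; ring
  simp_rw [h]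
  rw [Finset.prod_one_add, finsetSum_coeff, esymF, Finset.powersetCard_eq_filter,
    Finset.sum_filter, Finset.mul_sum]
  refine Finset.sum_congr rfl fun s _ => ?_
  rw [Finset.prod_mul_distrib, Finset.prod_const, ← map_prod, coeff_C_mul, coeff_X_pow]
  by_cases hk : s.card = k
  · subst hk
    have : ∏ i ∈ s, -(t * w i) = (-1) ^ s.card * t ^ s.card * ∏ i ∈ s, w i := by
      rw [← Finset.prod_const, ← Finset.prod_const, ← Finset.prod_mul_distrib,
        ← Finset.prod_mul_distrib]
      exact Finset.prod_congr rfl fun i _ => by ring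
    simp [this]
  · simp [hk, Ne.symm hk]

open Polynomial in
lemma Acl_eq (q : ℂ) (n m : ℕ) (y : ℂ) (w : Fin n → ℂ) :
    Acl q n m y w = TT (∏ i, (1 - C (q⁻¹ * w i) * X)) (y * q⁻¹ ^ n) m
      - TT (∏ i, (1 - C (q * w i) * X)) (y * q ^ n) m := by
  unfold Acl TT
  rw [← Finset.sum_sub_distrib]
  refine Finset.sum_congr rfl fun κ _ => ?_
  rw [coeff_esym, coeff_esym, mul_pow, mul_pow, pow_add, pow_add, pow_mul, pow_mul]
  ring

lemma Acl_zero (q : ℂ) (n : ℕ) (y : ℂ) (w : Fin n → ℂ) : Acl q n 0 y w = 0 := by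
  simp [Acl]

open Polynomial in
/-- The weighted sum of the undeformed entries. -/
lemma Bsum (k : ℕ) (q : ℂ) (hq : q ≠ 0) (c y : ℂ) (w : Fin (k + 3) → ℂ)
    (i0 i1 : Fin (k + 3)) (r : Finset (Fin (k + 3))) (h01 : i0 ∉ insert i1 r) (h1 : i1 ∉ r)
    (hu : Finset.univ = insert i0 (insert i1 r))
    (hw0 : w i0 = c * q⁻¹) (hw1 : w i1 = c * q) :
    y * ∑ l ∈ Finset.range (k + 1), c ^ l * Acl q (k + 3) (k + 1 - l) y w
      = (y * q⁻¹ ^ (k + 1) - c) * ∏ j ∈ r, (y * q⁻¹ ^ (k + 2) - w j)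
        - (y * q ^ (k + 1) - c) * ∏ j ∈ r, (y * q ^ (k + 2) - w j) := by
  have hr : r.card = k + 1 := by
    have := congrArg Finset.card hu
    rw [Finset.card_insert_of_notMem h01, Finset.card_insert_of_notMem h1] at this
    simp at this
    omega
  have h0r : i0 ∉ r := fun h => h01 (Finset.mem_insert_of_mem h)
  have e1 : ∏ i, (1 - C (q⁻¹ * w i) * X)
      = (1 - C c * X) * ∏ i ∈ insert i0 r, (1 - C (q⁻¹ * w i) * X) := by
    rw [hu, Finset.prod_insert h01, Finset.prod_insert h1, Finset.prod_insert h0r, hw1]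
    rw [show q⁻¹ * (c * q) = c by field_simp]; ring
  have e2 : ∏ i, (1 - C (q * w i) * X)
      = (1 - C c * X) * ∏ i ∈ insert i1 r, (1 - C (q * w i) * X) := by
    rw [hu, Finset.prod_insert h01, hw0]
    rw [show q * (c * q⁻¹) = c by field_simp]
  have hs : ∑ l ∈ Finset.range (k + 1), c ^ l * Acl q (k + 3) (k + 1 - l) y w
      = TT (∏ i ∈ insert i0 r, (1 - C (q⁻¹ * w i) * X)) (y * q⁻¹ ^ (k + 3)) (k + 1)
        - TT (∏ i ∈ insert i1 r, (1 - C (q * w i) * X)) (y * q ^ (k + 3)) (k + 1) := by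
    rw [← TT_tel _ c, ← TT_tel _ c, ← Finset.sum_sub_distrib, Finset.sum_range_succ _ (k + 1)]
    rw [← e1, ← e2]
    simp_rw [← mul_sub, ← Acl_eq]
    rw [Nat.sub_self, Acl_zero]; ring
  have f1 := TT_sub (insert i0 r) (fun i => q⁻¹ * w i) (y * q⁻¹ ^ (k + 3)) (k + 1)
    (by rw [Finset.card_insert_of_notMem h0r, hr])
  have f2 := TT_sub (insert i1 r) (fun i => q * w i) (y * q ^ (k + 3)) (k + 1)
    (by rw [Finset.card_insert_of_notMem h1, hr])
  have g : ∀ t a : ℂ, ∏ j ∈ r, (a * t ^ (k + 3) - t * w j)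
      = t ^ (k + 1) * ∏ j ∈ r, (a * t ^ (k + 2) - w j) := by
    intro t a
    rw [← hr, ← Finset.prod_const, ← Finset.prod_mul_distrib]
    exact Finset.prod_congr rfl fun i _ => by ring
  have g1 := g q⁻¹ y
  have g2 := g q y
  have g3 : ∀ t : ℂ, ∏ j ∈ r, (0 - t * w j) = t ^ (k + 1) * ∏ j ∈ r, (0 - w j) := by
    intro t
    rw [← hr, ← Finset.prod_const, ← Finset.prod_mul_distrib]
    exact Finset.prod_congr rfl fun i _ => by ring
  rw [hs]
  generalize TT (∏ i ∈ insert i0 r, (1 - C (q⁻¹ * w i) * X)) (y * q⁻¹ ^ (k + 3)) (k + 1) = A at *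
  generalize TT (∏ i ∈ insert i1 r, (1 - C (q * w i) * X)) (y * q ^ (k + 3)) (k + 1) = B at *
  rw [Finset.prod_insert h0r, Finset.prod_insert h0r, hw0, g1, g3] at f1
  rw [Finset.prod_insert h1, Finset.prod_insert h1, hw1, g2, g3] at f2
  generalize ∏ j ∈ r, (y * q⁻¹ ^ (k + 2) - w j) = U at *
  generalize ∏ j ∈ r, (y * q ^ (k + 2) - w j) = V at *
  generalize ∏ j ∈ r, (0 - w j) = W at *
  have a1 : y * A = (y * q⁻¹ ^ (k + 1) - c) * U + c * W := by
    have : q⁻¹ ^ (k + 3) ≠ 0 := by positivity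
    apply mul_left_cancel₀ this
    linear_combination f1
  have a2 : y * B = (y * q ^ (k + 1) - c) * V + c * W := by
    have : q ^ (k + 3) ≠ 0 := by positivity
    apply mul_left_cancel₀ this
    linear_combination f2
  linear_combination a1 - a2

/-- linear dependence of the columns of the deformed matrix:
for `n ≥ 3`, `Σ_{λ=0}^{n-3} (z₁τ^{2n-1})^λ Ã_{n-2-λ}(x | z₁, z₁τ^{2n-2}, z₃, …, z_n) = 0`
(wherever the denominators are nonzero), with `τ = q⁻¹`. -/
theorem Atl_linear_dependence (n : ℕ) (hn : 3 ≤ n) (q : ℂ) (hq : q ≠ 0)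
    (x : ℂ) (hx : x ≠ 0) (z : Fin n → ℂ)
    (hz2 : z ⟨1, by omega⟩ = z ⟨0, by omega⟩ * (q⁻¹) ^ (2 * n - 2))
    (hd1 : x - z ⟨0, by omega⟩ * (q⁻¹) ^ (n + 1) ≠ 0)
    (hd2 : ∀ j : Fin n, 0 < (j : ℕ) → z ⟨0, by omega⟩ * (q⁻¹) ^ 2 - z j ≠ 0) :
    ∑ lam ∈ Finset.range (n - 2),
      (z ⟨0, by omega⟩ * (q⁻¹) ^ (2 * n - 1)) ^ lam * Atl q n (by omega) (n - 2 - lam) x z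
      = 0 := by
  obtain ⟨k, rfl⟩ : ∃ k, n = k + 3 := ⟨n - 3, by omega⟩
  set i0 : Fin (k + 3) := ⟨0, by omega⟩ with hi0
  set i1 : Fin (k + 3) := ⟨1, by omega⟩ with hi1
  set r : Finset (Fin (k + 3)) := Finset.univ.filter (fun j => 1 < (j : ℕ)) with hr
  have v0 : (i0 : ℕ) = 0 := rfl
  have v1 : (i1 : ℕ) = 1 := rfl
  have h1 : i1 ∉ r := by simp [hr, hi1]
  have h01 : i0 ∉ insert i1 r := by simp [hr, hi1, hi0]
  have hs : Finset.univ.filter (fun j : Fin (k + 3) => 0 < (j : ℕ)) = insert i1 r := by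
    ext j
    simp only [hr, Finset.mem_filter, Finset.mem_univ, true_and, Finset.mem_insert, Fin.ext_iff]
    omega
  have hu : Finset.univ = insert i0 (insert i1 r) := by
    rw [← hs]
    ext j
    simp only [Finset.mem_filter, Finset.mem_univ, true_and, true_iff, Finset.mem_insert, Fin.ext_iff]
    omega
  set a := z i0 with ha
  set w := Function.update z i0 (a * q⁻¹ ^ (2 * (k + 3))) with hw
  set c := a * q⁻¹ ^ (2 * (k + 3) - 1) with hc
  have hc' : c = a * q⁻¹ ^ (2 * k + 5) := by rw [hc]; congr 2
  have hz2' : z i1 = a * q⁻¹ ^ (2 * k + 4) := by rw [hz2]; congr 2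
  have hw0 : w i0 = c * q⁻¹ := by
    rw [hw, Function.update_self, hc']; ring
  have hwj : ∀ j, j ≠ i0 → w j = z j := fun j hj => Function.update_of_ne hj _ _
  have h10 : i1 ≠ i0 := fun h => h01 (by simp [h])
  have hw1 : w i1 = c * q := by
    rw [hwj _ h10, hz2', hc', pow_succ _ (2 * k + 4)]; field_simp
  have hB := fun y => Bsum k q hq c y w i0 i1 r h01 h1 hu hw0 hw1
  have hwr : ∀ b : ℂ, ∏ j ∈ r, (b - w j) = ∏ j ∈ r, (b - z j) := fun b =>
    Finset.prod_congr rfl fun j hj => by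
      rw [hwj j]; rintro rfl; exact h01 (Finset.mem_insert_of_mem hj)
  simp only [hwr] at hB
  have hBx := hB x
  have hB0 := hB (a * q⁻¹ ^ (k + 4))
  have hd := hd2 i1 (by simp [hi1])
  have hD : ∏ j ∈ r, (a * q⁻¹ ^ 2 - z j) ≠ 0 := Finset.prod_ne_zero_iff.2 fun j hj =>
    hd2 j (by have := (Finset.mem_filter.1 hj).2; omega)
  have hsum : ∑ l ∈ Finset.range (k + 3 - 2), c ^ l * Atl q (k + 3) (by omega) (k + 3 - 2 - l) x z
      = (x - a * q⁻¹ ^ (k + 2)) / (x - a * q⁻¹ ^ (k + 4)) *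
          (∑ l ∈ Finset.range (k + 1), c ^ l * Acl q (k + 3) (k + 1 - l) x w)
        + gcl q (k + 3) (by omega) x z *
          (∑ l ∈ Finset.range (k + 1), c ^ l * Acl q (k + 3) (k + 1 - l) (a * q⁻¹ ^ (k + 4)) w) := by
    rw [Finset.mul_sum, Finset.mul_sum, ← Finset.sum_add_distrib]
    refine Finset.sum_congr rfl fun l _ => ?_
    simp only [Atl, ← hi0, ← ha, ← hw]
    rw [show k + 3 - 2 - l = k + 1 - l by omega, show k + 3 - 1 = k + 2 by omega]
    ring
  rw [hsum]
  simp only [gcl, hs, Finset.prod_insert h1, ← hi0, ← ha, Finset.prod_div_distrib]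
  rw [show k + 3 - 1 = k + 2 by omega]
  have hd1' : x - a * q⁻¹ ^ (k + 4) ≠ 0 := hd1
  generalize ∑ l ∈ Finset.range (k + 1), c ^ l * Acl q (k + 3) (k + 1 - l) x w = S at *
  generalize ∑ l ∈ Finset.range (k + 1), c ^ l * Acl q (k + 3) (k + 1 - l) (a * q⁻¹ ^ (k + 4)) w
    = S0 at *
  have hqq : q⁻¹ * q = 1 := inv_mul_cancel₀ hq
  have hx2 : a * q⁻¹ ^ (k + 4) * q ^ (k + 2) = a * q⁻¹ ^ 2 := by
    have : q⁻¹ ^ (k + 2) * q ^ (k + 2) = 1 := by rw [← mul_pow, hqq, one_pow]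
    linear_combination a * q⁻¹ ^ 2 * this
  rw [hx2] at hB0
  generalize ∏ j ∈ r, (a * q⁻¹ ^ 2 - z j) = D at *
  generalize ∏ j ∈ r, (x * q⁻¹ ^ (k + 2) - z j) = U at *
  generalize ∏ j ∈ r, (x * q ^ (k + 2) - z j) = V at *
  rw [hc'] at hB0 hBx
  rw [hz2'] at hd ⊢
  have hk : q⁻¹ ^ k * q ^ k = 1 := by rw [← mul_pow, hqq, one_pow]
  -- value at the special point
  have hB0' : a * q⁻¹ ^ (k + 4) * S0 = -(q⁻¹ * (a * q⁻¹ ^ 2 - a * q⁻¹ ^ (2 * k + 4)) * D) := by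
    have e1 : a * q⁻¹ ^ (k + 4) * q ^ (k + 1) = a * q⁻¹ ^ 3 := by
      have : q⁻¹ ^ (k + 1) * q ^ (k + 1) = 1 := by rw [← mul_pow, hqq, one_pow]
      linear_combination a * q⁻¹ ^ 3 * this
    rw [e1] at hB0
    linear_combination hB0
  apply mul_left_cancel₀ hx
  have key : ∀ ρ : ℂ, ρ * (x - a * q⁻¹ ^ (k + 4)) = x - a * q⁻¹ ^ (k + 2) →
      x * (ρ * S + a * q⁻¹ ^ (k + 3 + 1) / x * (q ^ 2 * ((x * q⁻¹ ^ (k + 2) - a * q⁻¹ ^ (2 * k + 4)) /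
        (a * q⁻¹ ^ 2 - a * q⁻¹ ^ (2 * k + 4)) * (U / D)) -
        ρ * ((x * q ^ (k + 2) - a * q⁻¹ ^ (2 * k + 4)) /
        (a * q⁻¹ ^ 2 - a * q⁻¹ ^ (2 * k + 4)) * (V / D))) * S0) = x * 0 := by
    intro ρ hρ
    generalize hE : a * q⁻¹ ^ 2 - a * q⁻¹ ^ (2 * k + 4) = E at *
    have e : x * (ρ * S + a * q⁻¹ ^ (k + 3 + 1) / x * (q ^ 2 *
        ((x * q⁻¹ ^ (k + 2) - a * q⁻¹ ^ (2 * k + 4)) / E * (U / D)) -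
        ρ * ((x * q ^ (k + 2) - a * q⁻¹ ^ (2 * k + 4)) / E * (V / D))) * S0)
        = ρ * (x * S) + (a * q⁻¹ ^ (k + 4) * S0) / (E * D) *
          (q ^ 2 * (x * q⁻¹ ^ (k + 2) - a * q⁻¹ ^ (2 * k + 4)) * U -
            ρ * (x * q ^ (k + 2) - a * q⁻¹ ^ (2 * k + 4)) * V) := by
      generalize q⁻¹ ^ (k + 2) = t1
      generalize q⁻¹ ^ (2 * k + 4) = t2
      rw [show k + 3 + 1 = k + 4 by omega]
      generalize q⁻¹ ^ (k + 4) = t3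
      field_simp
    rw [e, hB0', hBx]
    have e2 : -(q⁻¹ * E * D) / (E * D) = -q⁻¹ := by field_simp
    rw [e2]
    have m1 : q⁻¹ * q ^ 2 * (x * q⁻¹ ^ (k + 2) - a * q⁻¹ ^ (2 * k + 4))
        = q⁻¹ ^ (k + 1) * (x - a * q⁻¹ ^ (k + 2)) := by
      have : q⁻¹ * q ^ 2 * q⁻¹ = 1 := by field_simp
      linear_combination (x * q⁻¹ ^ (k + 1) - a * q⁻¹ ^ (2 * k + 3)) * this
    have m2 : q⁻¹ * (x * q ^ (k + 2) - a * q⁻¹ ^ (2 * k + 4))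
        = x * q ^ (k + 1) - a * q⁻¹ ^ (2 * k + 5) := by
      linear_combination x * q ^ (k + 1) * hqq
    linear_combination (-U) * m1 + ρ * V * m2 + q⁻¹ ^ (k + 1) * U * hρ
  exact key _ (div_mul_cancel₀ _ hd1')
end
end

section
/- For n ≥ 3, Π_{μ=2}^{n−2} (x_μ − z_1τ) · Δ(z_1τ^{−1}, x_2, …, x_{n−2} | z_1τ^{−n}, z_2, …, z_n) = Π_{μ=2}^{n−2} (x_μ − z_1τ^{−1}) · Δ(z_1τ, x_2, …, x_{n−2} | z_1τ^{n}, z_2, …, z_n). -/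
noncomputable section

/-- `Δ(x₁,…,x_{n-2} | z₁,…,z_n) = det( A_λ(x_μ | z) )_{1 ≤ λ, μ ≤ n-2}`. -/
def Dcl (q : ℂ) (n : ℕ) (x : Fin (n - 2) → ℂ) (z : Fin n → ℂ) : ℂ :=
  Matrix.det (Matrix.of fun lam μ : Fin (n - 2) => Acl q n ((lam : ℕ) + 1) (x μ) z)

open PowerSeries in
/-- `∏ (1 - s z_i X)`. -/
def genP {N : ℕ} (s : ℂ) (z : Fin N → ℂ) : PowerSeries ℂ :=
  ∏ i, (1 + C (-s * z i) * X)

open PowerSeries in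
lemma coeff_genP {N : ℕ} (s : ℂ) (z : Fin N → ℂ) (k : ℕ) :
    coeff k (genP s z) = (-s) ^ k * esymF z k := by
  unfold genP esymF
  rw [Finset.prod_one_add, map_sum, Finset.mul_sum, Finset.powersetCard_eq_filter,
    Finset.sum_filter]
  refine Finset.sum_congr rfl fun t _ => ?_
  rw [Finset.prod_mul_distrib, Finset.prod_const, ← map_prod, coeff_C_mul, coeff_X_pow,
    Finset.prod_mul_distrib, Finset.prod_const]
  by_cases h : t.card = k
  · simp [h]
  · simp [h, Ne.symm h]

open PowerSeries in
lemma geo_mul (c : ℂ) : (1 - C c * X) * (PowerSeries.mk fun k => c ^ k) = 1 := by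
  ext k
  cases k with
  | zero => simp
  | succ k =>
    rw [sub_mul, one_mul, map_sub, mul_assoc, coeff_C_mul, coeff_succ_X_mul]
    simp [coeff_one, pow_succ, mul_comm]

open PowerSeries in
/-- Generating function of the `A_λ`. -/
def genA (q : ℂ) (n : ℕ) (x : ℂ) (z : Fin n → ℂ) : PowerSeries ℂ :=
  PowerSeries.mk fun l => Acl q n l x z

open PowerSeries in
lemma genA_eq (q : ℂ) (n : ℕ) (x : ℂ) (z : Fin n → ℂ) :
    genA q n x z = genP q⁻¹ z * (PowerSeries.mk fun k => (x * q⁻¹ ^ n) ^ k)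
      - genP q z * (PowerSeries.mk fun k => (x * q ^ n) ^ k) := by
  ext l
  rw [map_sub, coeff_mul, coeff_mul, Finset.Nat.sum_antidiagonal_eq_sum_range_succ_mk,
    Finset.Nat.sum_antidiagonal_eq_sum_range_succ_mk, ← Finset.sum_sub_distrib]
  simp only [genA, coeff_mk, Acl, coeff_genP]
  refine Finset.sum_congr rfl fun k _ => ?_
  rw [neg_pow q⁻¹, neg_pow q, mul_pow, mul_pow, pow_add, pow_add, pow_mul, pow_mul]
  ring

open PowerSeries in
lemma coeff_zero_genA (q : ℂ) (n : ℕ) (x : ℂ) (z : Fin n → ℂ) : coeff 0 (genA q n x z) = 0 := by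
  simp [genA, Acl]

open PowerSeries in
lemma genP_update {N : ℕ} (s : ℂ) (z : Fin N → ℂ) (i : Fin N) (v : ℂ) :
    genP s (Function.update z i v) = (1 - C (s * v) * X) *
      ∏ j ∈ Finset.univ.erase i, (1 + C (-s * z j) * X) := by
  unfold genP
  rw [← Finset.mul_prod_erase _ _ (Finset.mem_univ i)]
  congr 1
  · simp [sub_eq_add_neg]
  · refine Finset.prod_congr rfl fun j hj => ?_
    rw [Function.update_of_ne (Finset.ne_of_mem_erase hj)]

open PowerSeries in
lemma det_row (k : ℕ) (f : Fin k → PowerSeries ℂ) (hf : ∀ i, coeff 0 (f i) = 0) (c : ℂ) :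
    Matrix.det (Matrix.of fun l μ : Fin k => coeff ((l : ℕ) + 1) (f μ)) =
    Matrix.det (Matrix.of fun l μ : Fin k => coeff ((l : ℕ) + 1) ((1 - C c * X) * f μ)) := by
  have key : ∀ (l : ℕ) (g : PowerSeries ℂ),
      coeff (l + 1) ((1 - C c * X) * g) = coeff (l + 1) g - c * coeff l g := by
    intro l g
    rw [sub_mul, one_mul, map_sub, mul_assoc, coeff_C_mul, coeff_succ_X_mul]
  cases k with
  | zero => simp
  | succ k =>
    -- B (i+1) = A (i+1) - c * A i
    symm
    rw [← Matrix.det_transpose, ← Matrix.det_transpose (Matrix.of fun l μ : Fin (k+1) => coeff ((l : ℕ) + 1) (f μ))]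
    symm
    refine Matrix.det_eq_of_forall_col_eq_smul_add_pred (fun _ => c) ?_ ?_
    · intro i
      simp [key, hf]
    · intro i j
      simp [key]

open PowerSeries in
lemma det_main (k : ℕ) (i0 : Fin k) (f g : Fin k → PowerSeries ℂ) (a b : ℂ)
    (hf : ∀ i, coeff 0 (f i) = 0) (hg : ∀ i, coeff 0 (g i) = 0) (u v c : Fin k → ℂ)
    (h0 : (1 - C b * X) * f i0 = (1 - C a * X) * g i0)
    (h : ∀ i, i ≠ i0 → C (u i) * ((1 - C b * X) * f i) =
      C (v i) * ((1 - C a * X) * g i) + C (c i) * ((1 - C a * X) * g i0)) :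
    (∏ i ∈ Finset.univ.erase i0, u i) *
        Matrix.det (Matrix.of fun l μ : Fin k => coeff ((l : ℕ) + 1) (f μ)) =
      (∏ i ∈ Finset.univ.erase i0, v i) *
        Matrix.det (Matrix.of fun l μ : Fin k => coeff ((l : ℕ) + 1) (g μ)) := by
  have hp : ∀ w : Fin k → ℂ, ∏ i ∈ Finset.univ.erase i0, w i =
      ∏ i, Function.update w i0 1 i := by
    intro w
    rw [← Finset.mul_prod_erase _ _ (Finset.mem_univ i0), Function.update_self, one_mul]
    exact Finset.prod_congr rfl fun j hj => by
      rw [Function.update_of_ne (Finset.ne_of_mem_erase hj)]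
  rw [det_row k f hf b, det_row k g hg a, hp, hp, ← Matrix.det_mul_row, ← Matrix.det_mul_row]
  refine (Matrix.det_transpose _).symm.trans (Eq.trans ?_ (Matrix.det_transpose _))
  refine Matrix.det_eq_of_forall_row_eq_smul_add_const (Function.update c i0 0) i0 (by simp) ?_
  intro j l
  by_cases hj : j = i0
  · subst hj
    simp only [Matrix.transpose_apply, Matrix.of_apply, Function.update_self, h0]
    ring
  · have := congrArg (coeff ((l : ℕ) + 1)) (h j hj)
    rw [map_add, coeff_C_mul, coeff_C_mul, coeff_C_mul] at this
    simp only [Matrix.transpose_apply, Matrix.of_apply, Function.update_self, Function.update_of_ne hj, this]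
    ring

/-- for `n ≥ 3`,
`Π_{μ=2}^{n-2} (x_μ - z₁τ) Δ(z₁τ⁻¹, x₂, …, x_{n-2} | z₁τ^{-n}, z₂, …, z_n)
  = Π_{μ=2}^{n-2} (x_μ - z₁τ⁻¹) Δ(z₁τ, x₂, …, x_{n-2} | z₁τ^n, z₂, …, z_n)`,
with `τ = q⁻¹`. -/
theorem Dcl_symmetry (n : ℕ) (hn : 3 ≤ n) (q : ℂ) (hq : q ≠ 0)
    (x : Fin (n - 2) → ℂ) (z : Fin n → ℂ) :
    (∏ μ ∈ Finset.univ.filter (fun μ : Fin (n - 2) => 0 < (μ : ℕ)),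
        (x μ - z ⟨0, by omega⟩ * q⁻¹)) *
      Dcl q n (Function.update x ⟨0, by omega⟩ (z ⟨0, by omega⟩ * q))
        (Function.update z ⟨0, by omega⟩ (z ⟨0, by omega⟩ * q ^ n))
    = (∏ μ ∈ Finset.univ.filter (fun μ : Fin (n - 2) => 0 < (μ : ℕ)),
        (x μ - z ⟨0, by omega⟩ * q)) *
      Dcl q n (Function.update x ⟨0, by omega⟩ (z ⟨0, by omega⟩ * q⁻¹))
        (Function.update z ⟨0, by omega⟩ (z ⟨0, by omega⟩ * (q⁻¹) ^ n)) := by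
  have hfil : Finset.univ.filter (fun μ : Fin (n - 2) => 0 < (μ : ℕ)) =
      Finset.univ.erase ⟨0, by omega⟩ := by
    ext μ
    simp [Fin.ext_iff, Nat.pos_iff_ne_zero]
  rw [hfil]
  generalize hi : (⟨0, by omega⟩ : Fin (n - 2)) = i0
  generalize hk : (⟨0, by omega⟩ : Fin n) = k0
  generalize hw : z k0 = w
  set t := q⁻¹ with ht
  have hqt : q * t = 1 := mul_inv_cancel₀ hq
  obtain ⟨N, rfl⟩ : ∃ N, n = N + 1 := ⟨n - 1, by omega⟩
  have hQT : q ^ N * t ^ N = 1 := by rw [← mul_pow, hqt, one_pow]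
  have hD : ∀ (y : Fin (N + 1 - 2) → ℂ) (z' : Fin (N + 1) → ℂ), Dcl q (N + 1) y z' =
      Matrix.det (Matrix.of fun l μ : Fin (N + 1 - 2) =>
        PowerSeries.coeff ((l : ℕ) + 1) (genA q (N + 1) (y μ) z')) := by
    intro y z'
    simp [Dcl, genA]
  rw [hD, hD]
  have e1 : t * (w * q ^ (N + 1)) = w * q ^ N := by
    linear_combination w * q ^ N * hqt
  have e2 : q * (w * t ^ (N + 1)) = w * t ^ N := by
    linear_combination w * t ^ N * hqt
  have e3 : q * (w * q ^ (N + 1)) = w * q ^ (N + 2) := by ring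
  have e4 : t * (w * t ^ (N + 1)) = w * t ^ (N + 2) := by ring
  have e5 : w * q * t ^ (N + 1) = w * t ^ N := by rw [← e2]; ring
  have e6 : w * q * q ^ (N + 1) = w * q ^ (N + 2) := by ring
  have e7 : w * t * t ^ (N + 1) = w * t ^ (N + 2) := by ring
  have e8 : w * t * q ^ (N + 1) = w * q ^ N := by rw [← e1]; ring
  have hQT : (PowerSeries.C q : PowerSeries ℂ) * PowerSeries.C t = 1 := by
    rw [← map_mul, hqt, map_one]
  have HF : (1 - PowerSeries.C (w * t ^ N) * PowerSeries.X) *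
      genA q (N + 1) (w * q) (Function.update z k0 (w * q ^ (N + 1))) =
      (1 - PowerSeries.C (w * q ^ N) * PowerSeries.X) *
        (∏ j ∈ Finset.univ.erase k0, (1 + PowerSeries.C (-t * z j) * PowerSeries.X)) -
      (1 - PowerSeries.C (w * t ^ N) * PowerSeries.X) *
        (∏ j ∈ Finset.univ.erase k0, (1 + PowerSeries.C (-q * z j) * PowerSeries.X)) := by
    rw [genA_eq, genP_update, genP_update, ← ht, e1, e3, e5, e6]
    have h1 := geo_mul (w * t ^ N)
    have h2 := geo_mul (w * q ^ (N + 2))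
    generalize (∏ j ∈ Finset.univ.erase k0,
      (1 + PowerSeries.C (-t * z j) * PowerSeries.X) : PowerSeries ℂ) = Rp
    generalize (∏ j ∈ Finset.univ.erase k0,
      (1 + PowerSeries.C (-q * z j) * PowerSeries.X) : PowerSeries ℂ) = Rm
    linear_combination (1 - PowerSeries.C (w * q ^ N) * PowerSeries.X) * Rp * h1 -
      (1 - PowerSeries.C (w * t ^ N) * PowerSeries.X) * Rm * h2
  have HG : (1 - PowerSeries.C (w * q ^ N) * PowerSeries.X) *
      genA q (N + 1) (w * t) (Function.update z k0 (w * t ^ (N + 1))) =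
      (1 - PowerSeries.C (w * q ^ N) * PowerSeries.X) *
        (∏ j ∈ Finset.univ.erase k0, (1 + PowerSeries.C (-t * z j) * PowerSeries.X)) -
      (1 - PowerSeries.C (w * t ^ N) * PowerSeries.X) *
        (∏ j ∈ Finset.univ.erase k0, (1 + PowerSeries.C (-q * z j) * PowerSeries.X)) := by
    rw [genA_eq, genP_update, genP_update, ← ht, e2, e4, e7, e8]
    have h1 := geo_mul (w * t ^ (N + 2))
    have h2 := geo_mul (w * q ^ N)
    generalize (∏ j ∈ Finset.univ.erase k0,
      (1 + PowerSeries.C (-t * z j) * PowerSeries.X) : PowerSeries ℂ) = Rp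
    generalize (∏ j ∈ Finset.univ.erase k0,
      (1 + PowerSeries.C (-q * z j) * PowerSeries.X) : PowerSeries ℂ) = Rm
    linear_combination (1 - PowerSeries.C (w * q ^ N) * PowerSeries.X) * Rp * h1 -
      (1 - PowerSeries.C (w * t ^ N) * PowerSeries.X) * Rm * h2
  refine det_main _ i0
    (fun μ => genA q (N + 1) (Function.update x i0 (w * q) μ)
      (Function.update z k0 (w * q ^ (N + 1))))
    (fun μ => genA q (N + 1) (Function.update x i0 (w * t) μ)
      (Function.update z k0 (w * t ^ (N + 1))))
    (w * q ^ N) (w * t ^ N) (fun _ => coeff_zero_genA _ _ _ _) (fun _ => coeff_zero_genA _ _ _ _)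
    (fun μ => x μ - w * t) (fun μ => x μ - w * q) (fun _ => w * (q - t)) ?_ ?_
  · simp only [Function.update_self]
    rw [HF, HG]
  · intro i hi'
    simp only [Function.update_self, Function.update_of_ne hi']
    rw [HG, genA_eq, genA_eq, genP_update, genP_update, genP_update, genP_update, ← ht,
      e1, e2, e3, e4]
    have h1 := geo_mul (x i * t ^ (N + 1))
    have h2 := geo_mul (x i * q ^ (N + 1))
    have E1 : PowerSeries.C (x i - w * t) * (1 - PowerSeries.C (w * t ^ N) * PowerSeries.X) -
        PowerSeries.C (x i - w * q) * (1 - PowerSeries.C (w * t ^ (N + 2)) * PowerSeries.X) =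
        PowerSeries.C (w * (q - t)) *
          (1 - PowerSeries.C (x i * t ^ (N + 1)) * PowerSeries.X) := by
      simp only [map_sub, map_mul, map_pow]
      linear_combination (PowerSeries.C (x i) * PowerSeries.C w * PowerSeries.C t ^ N -
        PowerSeries.C w ^ 2 * PowerSeries.C t ^ (N + 1)) * PowerSeries.X * hQT
    have E2 : PowerSeries.C (x i - w * t) *
          (1 - PowerSeries.C (w * q ^ (N + 2)) * PowerSeries.X) -
        PowerSeries.C (x i - w * q) * (1 - PowerSeries.C (w * q ^ N) * PowerSeries.X) =
        PowerSeries.C (w * (q - t)) *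
          (1 - PowerSeries.C (x i * q ^ (N + 1)) * PowerSeries.X) := by
      simp only [map_sub, map_mul, map_pow]
      linear_combination (PowerSeries.C w ^ 2 * PowerSeries.C q ^ (N + 1) -
        PowerSeries.C (x i) * PowerSeries.C w * PowerSeries.C q ^ N) * PowerSeries.X * hQT
    generalize (∏ j ∈ Finset.univ.erase k0,
      (1 + PowerSeries.C (-t * z j) * PowerSeries.X) : PowerSeries ℂ) = Rp
    generalize (∏ j ∈ Finset.univ.erase k0,
      (1 + PowerSeries.C (-q * z j) * PowerSeries.X) : PowerSeries ℂ) = Rm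
    generalize (PowerSeries.mk fun k => (x i * t ^ (N + 1)) ^ k) = gp at *
    generalize (PowerSeries.mk fun k => (x i * q ^ (N + 1)) ^ k) = gm at *
    generalize (1 - PowerSeries.C (w * q ^ N) * PowerSeries.X : PowerSeries ℂ) = a at *
    generalize (1 - PowerSeries.C (w * t ^ N) * PowerSeries.X : PowerSeries ℂ) = b at *
    linear_combination a * Rp * gp * E1 - b * Rm * gm * E2 +
      PowerSeries.C (w * (q - t)) * a * Rp * h1 - PowerSeries.C (w * (q - t)) * b * Rm * h2
end
end

section
/- Main identity for m = 1: for n ≥ 3, Δ̃(x_1, …, x_{n−2} | z_1, …, z_n) = Π_{j=2}^{n} ((z_j − z_1τ^{2n−2})/(z_j − z_1τ²)) · Δ(x_1, …, x_{n−2} | z_1, …, z_n), as an identity of rational functions (wherever the denominators are nonzero). -/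
noncomputable section

/-- `Δ̃(x₁,…,x_{n-2} | z₁,…,z_n) = det( Ã_λ(x_μ | z) )_{1 ≤ λ, μ ≤ n-2}`. -/
def Dtl (q : ℂ) (n : ℕ) (hn : 0 < n) (x : Fin (n - 2) → ℂ) (z : Fin n → ℂ) : ℂ :=
  Matrix.det (Matrix.of fun lam μ : Fin (n - 2) => Atl q n hn ((lam : ℕ) + 1) (x μ) z)

/-- The geometric series `1 / (1 - b X)`. -/
def geo (b : ℂ) : PowerSeries ℂ := PowerSeries.mk fun k => b ^ k

/-- `1 - b X`. -/
def lin (b : ℂ) : PowerSeries ℂ := 1 - PowerSeries.C b * PowerSeries.X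

lemma lin_mul_geo (b : ℂ) : lin b * geo b = 1 := by
  ext k
  rcases k with _ | k
  · simp [lin, geo, sub_mul, mul_assoc]
  · simp [lin, geo, sub_mul, mul_assoc, PowerSeries.coeff_succ_X_mul, pow_succ', PowerSeries.coeff_one]

lemma coeff_succ_lin_mul (b : ℂ) (P : PowerSeries ℂ) (k : ℕ) :
    PowerSeries.coeff (k + 1) (lin b * P)
      = PowerSeries.coeff (k + 1) P - b * PowerSeries.coeff k P := by
  simp [lin, sub_mul, mul_assoc, PowerSeries.coeff_succ_X_mul]

lemma coeff_zero_lin_mul (b : ℂ) (P : PowerSeries ℂ) :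
    PowerSeries.coeff 0 (lin b * P) = PowerSeries.coeff 0 P := by
  simp [lin, sub_mul, mul_assoc]

lemma coeff_succ_mul_geo (b : ℂ) (P : PowerSeries ℂ) (k : ℕ) :
    PowerSeries.coeff (k + 1) (P * geo b)
      = b * PowerSeries.coeff k (P * geo b) + PowerSeries.coeff (k + 1) P := by
  have h : P = lin b * (P * geo b) := by
    linear_combination (-P) * lin_mul_geo b
  have h2 := coeff_succ_lin_mul b (P * geo b) k
  rw [← h] at h2
  rw [h2]; ring

lemma rescale_lin (a b : ℂ) : PowerSeries.rescale a (lin b) = lin (a * b) := by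
  ext k
  rcases k with _ | k
  · simp [lin]
  · simp only [lin, PowerSeries.coeff_rescale, map_sub, PowerSeries.coeff_succ_mul_X, PowerSeries.coeff_one, PowerSeries.coeff_C]
    split_ifs with h1 h2 <;> simp_all

lemma rescale_geo (a b : ℂ) : PowerSeries.rescale a (geo b) = geo (a * b) := by
  ext k
  simp [geo, PowerSeries.coeff_rescale, mul_pow]

lemma coeff_prod_lin {ι : Type*} (s : Finset ι) (z : ι → ℂ) (k : ℕ) :
    PowerSeries.coeff k (∏ i ∈ s, lin (z i))
      = (-1) ^ k * ∑ t ∈ Finset.powersetCard k s, ∏ i ∈ t, z i := by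
  have h : ∀ t : Finset ι, PowerSeries.coeff k (∏ i ∈ t, (PowerSeries.C (-z i) * PowerSeries.X : PowerSeries ℂ))
      = if t.card = k then (-1) ^ k * ∏ i ∈ t, z i else 0 := by
    intro t
    rw [Finset.prod_mul_distrib, ← map_prod, PowerSeries.coeff_C_mul, Finset.prod_const,
      PowerSeries.coeff_X_pow, Finset.prod_neg]
    by_cases hk : t.card = k
    · simp [hk]
    · simp [hk, Ne.symm hk]
  have h1 : ∀ i, lin (z i) = 1 + PowerSeries.C (-z i) * PowerSeries.X := by
    intro i; simp [lin, sub_eq_add_neg]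
  simp_rw [h1]
  rw [Finset.prod_one_add, map_sum]
  simp_rw [h]
  rw [← Finset.sum_filter, Finset.mul_sum, Finset.powersetCard_eq_filter]

lemma coeff_prod_lin_of_lt {ι : Type*} (s : Finset ι) (z : ι → ℂ) (k : ℕ) (hk : s.card < k) :
    PowerSeries.coeff k (∏ i ∈ s, lin (z i)) = 0 := by
  rw [coeff_prod_lin, Finset.powersetCard_eq_empty.2 hk]; simp

lemma coeff_card_prod_lin_geo {ι : Type*} (s : Finset ι) (z : ι → ℂ) (t : ℂ) :
    PowerSeries.coeff s.card ((∏ i ∈ s, lin (z i)) * geo t) = ∏ i ∈ s, (t - z i) := by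
  classical
  induction s using Finset.induction_on with
  | empty => simp [geo]
  | insert a s ha ih =>
    rw [Finset.card_insert_of_notMem ha, Finset.prod_insert ha, Finset.prod_insert ha, mul_assoc,
      coeff_succ_lin_mul, coeff_succ_mul_geo, ih, coeff_prod_lin_of_lt _ _ _ (Nat.lt_succ_self _)]
    ring

lemma Acl_eq_coeff (q : ℂ) (n lam : ℕ) (x : ℂ) (z : Fin n → ℂ) :
    Acl q n lam x z = PowerSeries.coeff lam
      (PowerSeries.rescale q⁻¹ (∏ i, lin (z i)) * geo (x * q⁻¹ ^ n)
        - PowerSeries.rescale q (∏ i, lin (z i)) * geo (x * q ^ n)) := by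
  rw [map_sub, PowerSeries.coeff_mul, PowerSeries.coeff_mul, ← Finset.sum_sub_distrib,
    Finset.Nat.sum_antidiagonal_eq_sum_range_succ_mk, Acl]
  refine Finset.sum_congr rfl fun κ hκ => ?_
  simp only [PowerSeries.coeff_rescale, coeff_prod_lin, geo, PowerSeries.coeff_mk, esymF, mul_pow, pow_add, pow_mul]
  ring

lemma det_rank_one (N : ℕ) (GA GB : Fin N → PowerSeries ℂ) (h V : PowerSeries ℂ) (w : Fin N → ℂ)
    (d b : ℂ) (h0 : PowerSeries.coeff 0 h = 1) (hA0 : ∀ j, PowerSeries.coeff 0 (GA j) = 0)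
    (hB0 : ∀ j, PowerSeries.coeff 0 (GB j) = 0) (hV0 : PowerSeries.coeff 0 V = 0)
    (hrel : ∀ j, h * GB j = GA j + PowerSeries.C (w j) * V)
    (hw : ∀ j, w j = d * PowerSeries.coeff N (GA j * geo b)) :
    Matrix.det (Matrix.of fun i j : Fin N => PowerSeries.coeff ((i : ℕ) + 1) (GB j))
      = (1 + d * PowerSeries.coeff N (V * geo b)) *
        Matrix.det (Matrix.of fun i j : Fin N => PowerSeries.coeff ((i : ℕ) + 1) (GA j)) := by
  have key : ∀ P : PowerSeries ℂ, PowerSeries.coeff 0 P = 0 →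
      PowerSeries.coeff N (P * geo b)
        = ∑ i : Fin N, b ^ (N - 1 - (i : ℕ)) * PowerSeries.coeff ((i : ℕ) + 1) P := by
    intro P hP
    rw [PowerSeries.coeff_mul, Finset.Nat.sum_antidiagonal_eq_sum_range_succ_mk,
      Finset.sum_range_succ', hP, Finset.sum_range]
    simp only [zero_mul, add_zero]
    refine Finset.sum_congr rfl fun i _ => ?_
    rw [geo, PowerSeries.coeff_mk, mul_comm]
    congr 2
    omega
  let H : Matrix (Fin N) (Fin N) ℂ := Matrix.of fun i j =>
    if (j : ℕ) ≤ i then PowerSeries.coeff ((i : ℕ) - j) h else 0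
  have hH : H.det = 1 := by
    rw [Matrix.det_of_isLowerTriangular]
    · refine Finset.prod_eq_one fun i _ => ?_
      simpa [H] using h0
    · intro i j hij
      have : i < j := hij
      have h3 : ¬ (j ≤ i) := not_le.2 this
      simp [H, h3]
  let A : Matrix (Fin N) (Fin N) ℂ := Matrix.of fun i j => PowerSeries.coeff ((i : ℕ) + 1) (GA j)
  let B : Matrix (Fin N) (Fin N) ℂ := Matrix.of fun i j => PowerSeries.coeff ((i : ℕ) + 1) (GB j)
  let v : Fin N → ℂ := fun i => PowerSeries.coeff ((i : ℕ) + 1) V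
  let u : Fin N → ℂ := fun i => d * b ^ (N - 1 - (i : ℕ))
  have hmul : H * B = (1 + Matrix.replicateCol Unit v * Matrix.replicateRow Unit u) * A := by
    ext i j
    rw [add_mul, one_mul, Matrix.mul_assoc]
    have h1 : (H * B) i j = PowerSeries.coeff ((i : ℕ) + 1) (h * GB j) := by
      rw [mul_comm h, PowerSeries.coeff_mul, Finset.Nat.sum_antidiagonal_eq_sum_range_succ_mk,
        Finset.sum_range_succ', hB0, Matrix.mul_apply]
      simp only [zero_mul, add_zero, H, B, Matrix.of_apply, ite_mul]
      rw [Fin.sum_univ_eq_sum_range (fun j' => if j' ≤ (i : ℕ) then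
        PowerSeries.coeff ((i : ℕ) - j') h * PowerSeries.coeff (j' + 1) (GB j) else 0) N,
        ← Finset.sum_filter]
      refine Finset.sum_congr ?_ fun k _ => ?_
      · ext k
        have := i.2
        simp only [Finset.mem_filter, Finset.mem_range]
        omega
      · rw [mul_comm]
        congr 3
        omega
    rw [h1, hrel, map_add, PowerSeries.coeff_C_mul, hw, key _ (hA0 j)]
    simp [Matrix.mul_apply, A, v, u, Finset.mul_sum, Finset.sum_mul]
    refine Finset.sum_congr rfl fun k _ => ?_
    ring
  have hdet := congrArg Matrix.det hmul
  rw [Matrix.det_mul, Matrix.det_mul, hH, one_mul, Matrix.det_one_add_mul_comm] at hdet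
  change B.det = _ * A.det
  rw [hdet, key _ hV0]
  congr 1
  simp [Matrix.mul_apply, u, v, Finset.mul_sum, mul_assoc]

/-- the main identity for `m = 1`:
`Δ̃(x₁,…,x_{n-2} | z₁,…,z_n)
  = Π_{j=2}^n ((z_j - z₁τ^{2n-2}) / (z_j - z₁τ²)) Δ(x₁,…,x_{n-2} | z₁,…,z_n)`
(wherever the denominators are nonzero), with `τ = q⁻¹`. -/
theorem Dtl_eq_Dcl (n : ℕ) (hn : 3 ≤ n) (q : ℂ) (hq : q ≠ 0)
    (x : Fin (n - 2) → ℂ) (hx : ∀ μ, x μ ≠ 0)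
    (z : Fin n → ℂ)
    (hd1 : ∀ μ, x μ - z ⟨0, by omega⟩ * (q⁻¹) ^ (n + 1) ≠ 0)
    (hd2 : ∀ j : Fin n, 0 < (j : ℕ) → z j - z ⟨0, by omega⟩ * (q⁻¹) ^ 2 ≠ 0) :
    Dtl q n (by omega) x z
      = (∏ j ∈ Finset.univ.filter (fun j : Fin n => 0 < (j : ℕ)),
          (z j - z ⟨0, by omega⟩ * (q⁻¹) ^ (2 * n - 2)) /
            (z j - z ⟨0, by omega⟩ * (q⁻¹) ^ 2)) *
        Dcl q n x z := by
  obtain ⟨k, rfl⟩ : ∃ k, n = k + 3 := ⟨n - 3, by omega⟩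
  have htq : q⁻¹ * q = 1 := inv_mul_cancel₀ hq
  have hTU : q⁻¹ ^ (k + 3) * q ^ (k + 3) = 1 := by rw [← mul_pow, htq, one_pow]
  set t := q⁻¹ with ht
  have ht0 : t ≠ 0 := inv_ne_zero hq
  set T := t ^ (k + 3) with hT
  set U := q ^ (k + 3) with hU
  have e1 : t ^ (k + 3 - 1) = T * q := by
    rw [hT, show k + 3 - 1 = k + 2 from rfl, pow_succ t (k + 2), mul_assoc, htq, mul_one]
  have e2 : q ^ (k + 3 - 1) = U * t := by
    rw [hU, show k + 3 - 1 = k + 2 from rfl, pow_succ q (k + 2), mul_assoc, mul_comm q, htq,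
      mul_one]
  have e3 : t ^ (k + 3 + 1) = T * t := pow_succ _ _
  have e4 : t ^ (2 * (k + 3)) = T ^ 2 := by rw [hT, ← pow_mul, mul_comm]
  have e5 : t ^ (2 * (k + 3) - 2) = T ^ 2 * q ^ 2 := by
    rw [← e4, show 2 * (k + 3) = (2 * (k + 3) - 2) + 2 by omega, pow_add, mul_assoc, ← mul_pow,
      htq]
    simp
  have e6 : t ^ (k + 1) = T * q ^ 2 := by
    rw [hT, show k + 3 = k + 1 + 2 from rfl, pow_add t (k + 1) 2, mul_assoc, ← mul_pow, htq]
    simp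
  have e7 : q ^ (k + 1) = U * t ^ 2 := by
    rw [hU, show k + 3 = k + 1 + 2 from rfl, pow_add q (k + 1) 2, mul_assoc, ← mul_pow, mul_comm q, htq]
    simp
  have hz0 : (⟨0, by omega⟩ : Fin (k + 3)) = 0 := rfl
  simp only [hz0, e3, e5] at hd1 hd2 ⊢
  set a := z 0 with ha
  set s := Finset.univ.filter (fun j : Fin (k + 3) => 0 < (j : ℕ)) with hs
  have hs' : s = Finset.univ.erase 0 := by
    ext j
    simp [hs, Fin.pos_iff_ne_zero]
  have hcard : s.card = k + 2 := by
    rw [hs', Finset.card_erase_of_mem (Finset.mem_univ _)]; simp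
  set F : PowerSeries ℂ := ∏ j ∈ s, lin (z j) with hF
  have hE : ∏ i, lin (z i) = lin a * F := by
    rw [hF, hs', Finset.mul_prod_erase _ (fun i => lin (z i)) (Finset.mem_univ 0)]
  have hE' : ∏ i, lin (Function.update z 0 (a * T ^ 2) i) = lin (a * T ^ 2) * F := by
    rw [hF, hs', ← Finset.mul_prod_erase _ _ (Finset.mem_univ 0), Function.update_self]
    congr 1
    refine Finset.prod_congr rfl fun i hi => ?_
    rw [Function.update_of_ne (Finset.ne_of_mem_erase hi)]
  let Q : ℂ → ℂ := fun y => ∏ j ∈ s, (y - z j)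
  let R : ℂ → ℂ := fun y => PowerSeries.coeff (k + 1) (F * geo y)
  let f : ℂ := PowerSeries.coeff (k + 2) F
  have hQ : ∀ y, Q y = y * R y + f := by
    intro y
    have h1 := coeff_card_prod_lin_geo s z y
    rw [hcard, coeff_succ_mul_geo] at h1
    exact h1.symm
  have hD : Q (a * t ^ 2) ≠ 0 := by
    refine Finset.prod_ne_zero_iff.2 fun j hj => ?_
    have := hd2 j (by simpa [hs] using hj)
    intro h0
    exact this (by linear_combination -h0)
  let F1 := PowerSeries.rescale t F
  let F2 := PowerSeries.rescale q F
  have hR1 : ∀ y, PowerSeries.coeff (k + 1) (F1 * geo y) = T * q ^ 2 * R (y * q) := by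
    intro y
    have : F1 * geo y = PowerSeries.rescale t (F * geo (y * q)) := by
      rw [map_mul, rescale_geo]
      congr 2
      linear_combination (-y) * htq
    rw [this, PowerSeries.coeff_rescale, e6]
  have hR2 : ∀ y, PowerSeries.coeff (k + 1) (F2 * geo y) = U * t ^ 2 * R (y * t) := by
    intro y
    have : F2 * geo y = PowerSeries.rescale q (F * geo (y * t)) := by
      rw [map_mul, rescale_geo]
      congr 2
      linear_combination (-y) * htq
    rw [this, PowerSeries.coeff_rescale, e7]
  have hF0 : PowerSeries.coeff 0 F = 1 := by
    rw [hF, coeff_prod_lin]; simp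
  have hF10 : PowerSeries.constantCoeff F1 = 1 := by
    rw [← PowerSeries.coeff_zero_eq_constantCoeff_apply, PowerSeries.coeff_rescale, hF0]; simp
  have hF20 : PowerSeries.constantCoeff F2 = 1 := by
    rw [← PowerSeries.coeff_zero_eq_constantCoeff_apply, PowerSeries.coeff_rescale, hF0]; simp
  have hgeo0 : ∀ y, PowerSeries.constantCoeff (geo y) = 1 := by
    intro y; rw [← PowerSeries.coeff_zero_eq_constantCoeff_apply]; simp [geo]
  have hlin0 : ∀ y, PowerSeries.constantCoeff (lin y) = 1 := by
    intro y; simp [lin]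
  let c : Fin (k + 1) → ℂ := fun μ => (x μ - a * (T * q)) / (x μ - a * (T * t))
  have hc : ∀ μ, c μ * (x μ - a * (T * t)) = x μ - a * (T * q) := fun μ =>
    div_mul_cancel₀ _ (hd1 μ)
  let g : Fin (k + 1) → ℂ := fun μ => gcl q (k + 3) (by omega) (x μ) z
  have hg : ∀ μ, g μ * Q (a * t ^ 2) * x μ
      = a * (T * t) * (q ^ 2 * Q (x μ * (T * q)) - c μ * Q (x μ * (U * t))) := by
    intro μ
    have hxμ := hx μ
    simp only [g, gcl, hz0, ← ht, ← ha, ← hs, e1, e2, e3, Finset.prod_div_distrib]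
    change a * (T * t) / x μ * (q ^ 2 * (Q (x μ * (T * q)) / Q (a * t ^ 2))
      - c μ * (Q (x μ * (U * t)) / Q (a * t ^ 2))) * Q (a * t ^ 2) * x μ = _
    generalize c μ = c'
    field_simp
  let GA : Fin (k + 1) → PowerSeries ℂ := fun μ =>
    lin (t * a) * F1 * geo (x μ * T) - lin (q * a) * F2 * geo (x μ * U)
  let α := t * (a * T ^ 2)
  let γ := q * (a * T ^ 2)
  let GB : Fin (k + 1) → PowerSeries ℂ := fun μ =>
    PowerSeries.C (c μ) * (lin α * F1 * geo (x μ * T) - lin γ * F2 * geo (x μ * U))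
    + PowerSeries.C (g μ) * (lin α * F1 * geo α - lin γ * F2 * geo (t * a))
  have hGA : ∀ i μ, Acl q (k + 3) i (x μ) z = PowerSeries.coeff i (GA μ) := by
    intro i μ
    rw [Acl_eq_coeff, hE]
    simp only [map_mul (PowerSeries.rescale _), rescale_lin]
    rfl
  have hGB : ∀ i μ, Atl q (k + 3) (by omega) i (x μ) z = PowerSeries.coeff i (GB μ) := by
    intro i μ
    have h1 : a * (T * t) * T = α := by simp only [α]; ring
    have h2 : a * (T * t) * U = t * a := by linear_combination (a * t) * hTU
    simp only [Atl, hz0, ← ht, ← ha, e1, e3, e4, Acl_eq_coeff, hE', map_mul (PowerSeries.rescale _),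
      rescale_lin, ← hT, ← hU, h1, h2]
    simp only [GB, map_add, PowerSeries.coeff_C_mul]
    rfl
  let h : PowerSeries ℂ := lin (t * a) * geo γ
  let V : PowerSeries ℂ := h * F1 - F2
  let w : Fin (k + 1) → ℂ := fun μ => g μ + c μ - 1
  have l2 : ∀ μ, PowerSeries.C (c μ) * lin (t * a)
      = lin (q * a) + PowerSeries.C (c μ - 1) * lin (x μ * U) := by
    intro μ
    have : c μ * (t * a) = q * a + (c μ - 1) * (x μ * U) := by
      linear_combination (-U) * hc μ + (a * q - a * t * c μ) * hTU
    have := congrArg (PowerSeries.C (R := ℂ)) this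
    simp only [lin, map_mul, map_add, map_sub, map_one] at this ⊢
    linear_combination (-PowerSeries.X) * this
  have main := det_rank_one (k + 1) GA GB h V w (a * T / Q (a * t ^ 2)) (t * a) ?_ ?_ ?_ ?_ ?_ ?_
  · have hV : PowerSeries.coeff (k + 1) (V * geo (t * a))
        = T * q ^ 2 * R (γ * q) - U * t ^ 2 * R (t * a * t) := by
      rw [← hR1, ← hR2, ← map_sub]
      congr 1
      simp only [V, h]
      linear_combination (F1 * geo γ) * lin_mul_geo (t * a)
    have hK : (∏ j ∈ s, (z j - a * (T ^ 2 * q ^ 2)) / (z j - a * t ^ 2))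
        = Q (a * (T ^ 2 * q ^ 2)) / Q (a * t ^ 2) := by
      simp only [Q]
      rw [← Finset.prod_div_distrib]
      refine Finset.prod_congr rfl fun j _ => ?_
      rw [← neg_div_neg_eq, neg_sub, neg_sub]
    rw [hK]
    have hfin : 1 + a * T / Q (a * t ^ 2) * PowerSeries.coeff (k + 1) (V * geo (t * a))
        = Q (a * (T ^ 2 * q ^ 2)) / Q (a * t ^ 2) := by
      rw [hV, show γ * q = a * (T ^ 2 * q ^ 2) by simp only [γ]; ring,
        show t * a * t = a * t ^ 2 by ring]
      rw [eq_div_iff hD, add_mul, div_mul_eq_mul_div, div_mul_cancel₀ _ hD, hQ (a * t ^ 2),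
        hQ (a * (T ^ 2 * q ^ 2))]
      linear_combination (-a * t ^ 2 * R (a * t ^ 2)) * hTU
    rw [← hfin]
    simp only [Dtl, Dcl, hGA, hGB]
    exact main
  · simp [h, hlin0, hgeo0]
  · intro j
    simp [GA, hlin0, hgeo0, hF10, hF20]
  · intro j
    simp [GB, hlin0, hgeo0, hF10, hF20]
  · simp [V, h, hlin0, hgeo0, hF10, hF20]
  · intro μ
    have l1 : PowerSeries.C (c μ) * lin α = lin γ + PowerSeries.C (c μ - 1) * lin (x μ * T) := by
      have : c μ * α = γ + (c μ - 1) * (x μ * T) := by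
        simp only [α, γ]
        linear_combination (-T) * hc μ
      have := congrArg (PowerSeries.C (R := ℂ)) this
      simp only [lin, map_mul, map_add, map_sub, map_one] at this ⊢
      linear_combination (-PowerSeries.X) * this
    have l2 := l2 μ
    have m1 := lin_mul_geo α
    have m2 := lin_mul_geo γ
    have m3 := lin_mul_geo (x μ * T)
    have m4 := lin_mul_geo (x μ * U)
    have m5 := lin_mul_geo (t * a)
    have hwc : PowerSeries.C (w μ) = PowerSeries.C (g μ) + PowerSeries.C (c μ - 1) := by
      rw [← map_add]; congr 1; simp only [w]; ring
    rw [hwc]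
    simp only [h, GB, GA, V]
    linear_combination (lin (t * a) * geo γ * F1 * geo (x μ * T)) * l1
      + (lin (t * a) * F1 * geo (x μ * T) - PowerSeries.C (c μ) * lin (t * a) * F2 * geo (x μ * U)
        - PowerSeries.C (g μ) * lin (t * a) * F2 * geo (t * a)) * m2
      + (PowerSeries.C (c μ - 1) * lin (t * a) * geo γ * F1) * m3
      - (F2 * geo (x μ * U)) * l2 - (PowerSeries.C (c μ - 1) * F2) * m4
      + (PowerSeries.C (g μ) * lin (t * a) * geo γ * F1) * m1
      - (PowerSeries.C (g μ) * F2) * m5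
  · intro μ
    have l2 := l2 μ
    have m4 := lin_mul_geo (x μ * U)
    have m5 := lin_mul_geo (t * a)
    have hS : GA μ * geo (t * a) = F1 * geo (x μ * T)
        - (PowerSeries.C (c μ) * (F2 * geo (x μ * U))
          - PowerSeries.C (c μ - 1) * (F2 * geo (t * a))) := by
      simp only [GA]
      linear_combination (F1 * geo (x μ * T) - PowerSeries.C (c μ) * F2 * geo (x μ * U)) * m5
        + (F2 * geo (x μ * U) * geo (t * a)) * l2
        + (PowerSeries.C (c μ - 1) * F2 * geo (t * a)) * m4
    rw [hS, map_sub, map_sub, PowerSeries.coeff_C_mul, PowerSeries.coeff_C_mul, hR1, hR2, hR2,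
      div_mul_eq_mul_div, eq_div_iff hD]
    refine mul_right_cancel₀ (hx μ) ?_
    have hgμ := hg μ
    have hcμ := hc μ
    rw [show x μ * T * q = x μ * (T * q) by ring, show x μ * U * t = x μ * (U * t) by ring,
      show t * a * t = a * t ^ 2 by ring]
    have q1 := hQ (a * t ^ 2)
    rw [hQ (x μ * (T * q)), hQ (x μ * (U * t))] at hgμ
    simp only [w]
    generalize R (x μ * (T * q)) = R1 at *
    generalize R (x μ * (U * t)) = R2 at *
    generalize R (a * t ^ 2) = R3 at *
    generalize Q (a * t ^ 2) = D at *
    generalize c μ = c' at *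
    generalize g μ = g' at *
    linear_combination hgμ + ((c' - 1) * x μ) * q1 + f * hcμ
      + (a * T ^ 2 * q ^ 2 * x μ * R1 + a * T * q * f) * htq - (a * x μ * t ^ 2 * (c' - 1) * R3) * hTU
end
end

section
/- Determinant recursion (Proposition 5.2): for m ≥ 2, with M = (n−1)m − 1 and M_{m−1} = (n−1)(m−1) − 1, the restriction of Δ^{(m)}(x_1,…,x_M | z^{(n)}|…|z^{(1)}) to z_m^{(k)} = a τ^{2n−2k} (for all k = 1,…,n) equals Π_{μ=1}^{M} (x_μ − a τ^{n−1}) · Σ_{1≤μ_1<⋯<μ_{n−1}≤M} (−1)^{Σ_{i=1}^{n−1}(mn−m−n+i+μ_i)} det( h_α(x_{μ_i} | z') )_{1≤i,α≤n−1} · Δ^{(m−1)}( x \ {x_{μ_1},…,x_{μ_{n−1}}} | z'^{(n)}|…|z'^{(1)} ), where h_α(x|z') = A^{(m−1)}_{M_{m−1}+α}(x | z'^{(n)}|…|z'^{(1)}) and z'^{(k)} = (z_1^{(k)},…,z_{m−1}^{(k)}). -/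
noncomputable section

/-- The `k`-th elementary symmetric function of the entries of a list. -/
def esymL {R : Type*} [CommRing R] (l : List R) (k : ℕ) : R :=
  ((l.sublistsLen k).map List.prod).sum

/-- `f_λ^{(N)}(y | z₁,…,z_N)` where the variables are given as a list; the
deformation parameter `τ` and its inverse `τi` are passed separately so that
the definition makes sense over any commutative ring.  By the empty-sum
convention, `f_λ = 0` for `λ = 0`. -/
def fgenL {R : Type*} [CommRing R] (τ τi y : R) (lam : ℕ) (l : List R) : R :=
  ∑ κ ∈ Finset.range lam,
    (-1 : R) ^ κ * ((y * τ) ^ (lam - κ) - (y * τi) ^ (lam - κ)) * esymL l κ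

/-- `τ ^ a` for an integer exponent `a`, negative powers being interpreted
via the inverse `τi` of `τ`. -/
def mixpow {R : Type*} [CommRing R] (τ τi : R) (a : ℤ) : R :=
  if 0 ≤ a then τ ^ a.toNat else τi ^ (-a).toNat

/-- The argument list `z^{(n)}τ, …, z^{(k+1)}τ, z^{(k-1)}τ⁻¹, …, z^{(1)}τ⁻¹`
(the group `z^{(k)}` omitted); the group `z^{(k)}` is `Z (k-1)` (0-based). -/
def argList {R : Type*} [CommRing R] (n m : ℕ) (τ τi : R)
    (Z : Fin n → Fin m → R) (k : Fin n) : List R :=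
  (((List.finRange n).reverse.filter (fun g => k < g)).map
      (fun g => (List.finRange m).map (fun j => Z g j * τ))).flatten
  ++ (((List.finRange n).reverse.filter (fun g => g < k)).map
      (fun g => (List.finRange m).map (fun j => Z g j * τi))).flatten

/-- `x · A_λ^{(m)}(x | z^{(n)} | ⋯ | z^{(1)})`, i.e. the polynomial
`Σ_{k=1}^n Π_{j=1}^m (x - z_j^{(k)} τ^{2k-n-1}) ·
  f_λ^{((n-1)m)}(x τ^{n+1-2k} | z^{(n)}τ, …, z^{(k+1)}τ, z^{(k-1)}τ⁻¹, …, z^{(1)}τ⁻¹)`,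
the group `z^{(k)}` being `Z (k-1)` (0-based). -/
def numerA {R : Type*} [CommRing R] (n m : ℕ) (τ τi : R) (lam : ℕ) (x : R)
    (Z : Fin n → Fin m → R) : R :=
  ∑ k : Fin n,
    (∏ j : Fin m, (x - Z k j * mixpow τ τi (2 * ((k : ℕ) : ℤ) + 1 - (n : ℤ)))) *
      fgenL τ τi (x * mixpow τ τi ((n : ℤ) - (2 * ((k : ℕ) : ℤ) + 1))) lam
        (argList n m τ τi Z k)

/-- `A_λ^{(m)}(x | z^{(n)} | ⋯ | z^{(1)})` over `ℂ`, with `τ = q⁻¹`;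
the group `z^{(k)}` is `Z (k-1)` (0-based). -/
def Afun (q : ℂ) (n m lam : ℕ) (x : ℂ) (Z : Fin n → Fin m → ℂ) : ℂ :=
  numerA n m q⁻¹ q lam x Z / x

lemma compl_card_aux (n m : ℕ) (s : Finset (Fin ((n - 1) * m - 1)))
    (hs : s.card = n - 1) : sᶜ.card = (n - 1) * (m - 1) - 1 := by
  rw [Finset.card_compl, hs, Fintype.card_fin, Nat.mul_sub, Nat.mul_one,
    Nat.sub_right_comm]

theorem shuffle_sign (p r : ℕ) (π : Equiv.Perm (Fin (p + r)))
    (hc : StrictMono fun i : Fin p => π (Fin.castAdd r i))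
    (hs : StrictMono fun j : Fin r => π (Fin.natAdd p j)) :
    ((Equiv.Perm.sign π : ℤˣ) : ℤ) =
      (-1) ^ (∑ j : Fin r, (p + (j : ℕ) + (π (Fin.natAdd p j) : ℕ))) := by
  have hlt : ∀ i j : Fin p, (π (Fin.castAdd r i) < π (Fin.castAdd r j)) ↔ i < j :=
    fun i j => hc.lt_iff_lt
  have hlt' : ∀ i j : Fin r, (π (Fin.natAdd p i) < π (Fin.natAdd p j)) ↔ i < j :=
    fun i j => hs.lt_iff_lt
  have key : ∀ b : Fin r,
      (Finset.univ.filter fun i : Fin p => π (Fin.castAdd r i) < π (Fin.natAdd p b)).card + (b : ℕ)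
        = (π (Fin.natAdd p b) : ℕ) := by
    intro b
    have h1 : (π (Fin.natAdd p b) : ℕ) = ∑ k : Fin (p + r), if k < π (Fin.natAdd p b) then 1 else 0 := by
      rw [← Finset.card_filter]
      rw [Finset.filter_gt_eq_Iio, Fin.card_Iio]
    have h2 : (b : ℕ) = ∑ k : Fin r, if k < b then 1 else 0 := by
      rw [← Finset.card_filter]
      rw [Finset.filter_gt_eq_Iio, Fin.card_Iio]
    rw [h1, ← Equiv.sum_comp π, Fin.sum_univ_add, Finset.card_filter]
    simp only [hlt']
    rw [← h2]
  rw [Equiv.Perm.sign_eq_prod_prod_Iio]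
  have conv : ∀ j : Fin (p + r), (∏ i ∈ Finset.Iio j, (if π i < π j then (1 : ℤˣ) else -1))
      = ∏ i, if i < j then (if π i < π j then (1 : ℤˣ) else -1) else 1 := by
    intro j
    rw [← Finset.prod_filter, Finset.filter_gt_eq_Iio]
  simp only [conv]
  rw [Fin.prod_univ_add]
  have e1 : ∏ j : Fin p, (∏ i, if i < Fin.castAdd r j then
      (if π i < π (Fin.castAdd r j) then (1 : ℤˣ) else -1) else 1) = 1 := by
    apply Finset.prod_eq_one
    intro j _
    apply Finset.prod_eq_one
    intro i _
    refine Fin.addCases (fun i => ?_) (fun i => ?_) i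
    · simp only [hlt]
      by_cases h : i < j
      · simp [h]
      · rw [if_neg]
        intro hh
        have h6 := Fin.lt_def.mp hh
        simp only [Fin.val_natAdd, Fin.val_castAdd] at h6
        exact h (Fin.lt_def.mpr (by omega))
    · rw [if_neg]
      simp [Fin.lt_def]; omega
  rw [e1, one_mul]
  have e2 : ∀ j : Fin r, (∏ i, if i < Fin.natAdd p j then
      (if π i < π (Fin.natAdd p j) then (1 : ℤˣ) else -1) else 1) =
      (-1) ^ (p + (j : ℕ) + (π (Fin.natAdd p j) : ℕ)) := by
    intro j
    rw [Fin.prod_univ_add]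
    have : ∏ i : Fin r, (if Fin.natAdd p i < Fin.natAdd p j then
      (if π (Fin.natAdd p i) < π (Fin.natAdd p j) then (1 : ℤˣ) else -1) else 1) = 1 := by
      apply Finset.prod_eq_one
      intro i _
      simp only [hlt']
      by_cases h : i < j
      · simp [h]
      · rw [if_neg]
        intro hh
        have h6 := Fin.lt_def.mp hh
        simp only [Fin.val_natAdd, Fin.val_castAdd] at h6
        exact h (Fin.lt_def.mpr (by omega))
    rw [this, mul_one]
    have h3 : ∀ i : Fin p, Fin.castAdd r i < Fin.natAdd p j := by
      intro i; simp [Fin.lt_def]; omega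
    simp only [h3, if_true]
    rw [Finset.prod_ite]
    simp only [Finset.prod_const_one, one_mul, Finset.prod_const]
    have h4 := Finset.card_filter_add_card_filter_not (s := (Finset.univ : Finset (Fin p)))
      (fun i : Fin p => π (Fin.castAdd r i) < π (Fin.natAdd p j))
    rw [Finset.card_univ, Fintype.card_fin] at h4
    have h5 := key j
    rw [neg_one_pow_congr (n := _)]
    rw [Nat.even_iff, Nat.even_iff]
    omega
  simp only [e2, Finset.prod_pow_eq_pow_sum]
  simp

theorem laplace_gen {R : Type*} [CommRing R] (M p r : ℕ) (hM : M = p + r)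
    (A : Matrix (Fin M) (Fin M) R)
    (hcc : ∀ s : Finset (Fin M), s.card = r → sᶜ.card = p) :
    A.det = ∑ s ∈ (Finset.powersetCard r (Finset.univ : Finset (Fin M))).attach,
      ((-1 : R) ^ (∑ i : Fin r, (p + (i : ℕ) +
          (s.1.orderEmbOfFin (Finset.mem_powersetCard.mp s.2).2 i : ℕ)))) *
        Matrix.det (Matrix.of fun i α : Fin r =>
          A ⟨p + α, by omega⟩ (s.1.orderEmbOfFin (Finset.mem_powersetCard.mp s.2).2 i)) *
        Matrix.det (Matrix.of fun lam μ : Fin p =>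
          A ⟨lam, by omega⟩ ((s.1ᶜ).orderEmbOfFin
            (hcc s.1 (Finset.mem_powersetCard.mp s.2).2) μ)) := by
  subst hM
  classical
  let As : Finset (Fin (p + r)) → Matrix (Fin (p + r)) (Fin (p + r)) R := fun s =>
    Matrix.of fun i j => if (p ≤ (i : ℕ) ↔ j ∈ s) then A i j else 0
  have h1 : A.det = ∑ s ∈ Finset.powersetCard r (Finset.univ : Finset (Fin (p + r))),
      (As s).det := by
    simp only [Matrix.det_apply]
    rw [Finset.sum_comm]
    refine Finset.sum_congr rfl fun σ _ => ?_
    rw [← Finset.smul_sum]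
    congr 1
    simp only [As, Matrix.of_apply, Finset.prod_ite_zero]
    rw [Finset.sum_eq_single (Finset.univ.filter fun j => p ≤ (σ j : ℕ))]
    · simp
    · intro s _ hne
      rw [if_neg]
      intro h
      apply hne
      ext j
      simp [h j]
    · intro h
      exfalso
      apply h
      rw [Finset.mem_powersetCard]
      refine ⟨Finset.subset_univ _, ?_⟩
      rw [Finset.card_filter, Equiv.sum_comp σ (fun j => if p ≤ (j : ℕ) then 1 else 0),
        Fin.sum_univ_add]
      simp
  rw [h1, ← Finset.sum_attach]
  refine Finset.sum_congr rfl fun s _ => ?_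
  obtain ⟨s, hs⟩ := s
  have hs' := (Finset.mem_powersetCard.mp hs).2
  have hc' := hcc s hs'
  simp only
  let e : Fin p ⊕ Fin r ≃ Fin (p + r) := finSumFinEquiv
  let f : Fin p ⊕ Fin r ≃ Fin (p + r) := (Equiv.sumComm _ _).trans (finSumEquivOfFinset hs' hc')
  let π : Equiv.Perm (Fin (p + r)) := e.symm.trans f
  have hl : ∀ i, π (Fin.castAdd r i) = sᶜ.orderEmbOfFin hc' i := by
    intro i; simp [π, e, f]
  have hr : ∀ i, π (Fin.natAdd p i) = s.orderEmbOfFin hs' i := by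
    intro i; simp [π, e, f]
  have hsg := shuffle_sign p r π (by simp only [hl]; exact OrderEmbedding.strictMono _)
    (by simp only [hr]; exact OrderEmbedding.strictMono _)
  simp only [hr] at hsg
  have hd : ((As s).submatrix id π).det =
      (((-1 : ℤ) ^ (∑ i : Fin r, (p + (i : ℕ) + (s.orderEmbOfFin hs' i : ℕ))) : ℤ) : R)
        * (As s).det := by
    rw [Matrix.det_permute', ← hsg]
  have hb : (((As s).submatrix id π).submatrix e e) = Matrix.fromBlocks
      (Matrix.of fun lam μ : Fin p => A ⟨lam, by omega⟩ (sᶜ.orderEmbOfFin hc' μ)) 0 0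
      (Matrix.of fun α i : Fin r => A ⟨p + α, by omega⟩ (s.orderEmbOfFin hs' i)) := by
    have m1 : ∀ i, s.orderEmbOfFin hs' i ∈ s := fun i => Finset.orderEmbOfFin_mem _ _ _
    have m2 : ∀ i, sᶜ.orderEmbOfFin hc' i ∉ s := fun i =>
      Finset.mem_compl.mp (Finset.orderEmbOfFin_mem _ _ _)
    have e1 : ∀ i, e (Sum.inl i) = Fin.castAdd r i := fun i => by simp [e]
    have e2 : ∀ i, e (Sum.inr i) = Fin.natAdd p i := fun i => by simp [e]
    ext i j
    rcases i with i | i <;> rcases j with j | j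
    · simp [e1, hl, As, m2]; rfl
    · simp [e1, e2, hr, As, m1]
    · simp [e1, e2, hl, As, m2]
    · simp [e2, hr, As, m1]; rfl
  have hd2 := congrArg Matrix.det hb
  rw [Matrix.det_submatrix_equiv_self, hd, Matrix.det_fromBlocks_zero₂₁] at hd2
  rw [mul_assoc, mul_comm (Matrix.det _) (Matrix.det _), ← Matrix.det_transpose (Matrix.of fun i α : Fin r => _)]
  have ht : (Matrix.of fun i α : Fin r => A ⟨p + α, by omega⟩ (s.orderEmbOfFin hs' i)).transpose
    = Matrix.of fun α i : Fin r => A ⟨p + α, by omega⟩ (s.orderEmbOfFin hs' i) := rfl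
  rw [ht, ← hd2, ← mul_assoc]
  push_cast
  rw [← mul_pow]
  simp

theorem esymL_zero {R : Type*} [CommRing R] (l : List R) : esymL l 0 = 1 := by
  simp [esymL]

theorem esymL_cons {R : Type*} [CommRing R] (b : R) (l : List R) (k : ℕ) :
    esymL (b :: l) (k + 1) = esymL l (k + 1) + b * esymL l k := by
  simp [esymL, List.sublistsLen_succ_cons, List.map_append, List.sum_append, Function.comp_def,
    List.sum_map_mul_left]

theorem esymL_eq_esymm {R : Type*} [CommRing R] (l : List R) (k : ℕ) :
    esymL l k = (l : Multiset R).esymm k := by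
  simp [esymL, Multiset.esymm, Multiset.powersetCard_coe, Function.comp_def]

theorem fgenL_congr {R : Type*} [CommRing R] (τ τi y : R) (lam : ℕ) (l l' : List R)
    (h : (l : Multiset R) = (l' : Multiset R)) : fgenL τ τi y lam l = fgenL τ τi y lam l' := by
  simp only [fgenL, esymL_eq_esymm, h]

theorem fgenL_one_cons {R : Type*} [CommRing R] (τ τi y b : R) (l : List R) :
    fgenL τ τi y 1 (b :: l) = fgenL τ τi y 1 l := by
  simp [fgenL, esymL_zero]

theorem fgenL_succ_cons {R : Type*} [CommRing R] (τ τi y b : R) (lam : ℕ) (l : List R) :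
    fgenL τ τi y (lam + 1) l = fgenL τ τi y (lam + 1) (b :: l) + b * fgenL τ τi y lam l := by
  simp only [fgenL]
  rw [Finset.sum_range_succ', Finset.sum_range_succ' _ lam, Finset.mul_sum, add_right_comm,
    ← Finset.sum_add_distrib]
  congr 1
  · refine Finset.sum_congr rfl fun κ _ => ?_
    rw [esymL_cons, Nat.add_sub_add_right]
    ring
  · simp [esymL_zero]

/-- Prepending a common list of variables does not change the determinant. -/
theorem det_append {R : Type*} [CommRing R] (M n : ℕ) (τ τi : R) (P y : Fin n → Fin M → R)
    (l : Fin n → List R) (L : List R) :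
    Matrix.det (Matrix.of fun lam μ : Fin M =>
      ∑ k, P k μ * fgenL τ τi (y k μ) ((lam : ℕ) + 1) (L ++ l k)) =
    Matrix.det (Matrix.of fun lam μ : Fin M =>
      ∑ k, P k μ * fgenL τ τi (y k μ) ((lam : ℕ) + 1) (l k)) := by
  induction L with
  | nil => rfl
  | cons b L ih =>
    rw [← ih]
    symm
    cases M with
    | zero => simp
    | succ M =>
      apply Matrix.det_eq_of_forall_row_eq_smul_add_pred (fun _ => b)
      · intro j
        simp [fgenL_one_cons]
      · intro i j
        simp only [Matrix.of_apply, Fin.val_succ, Fin.val_castSucc, List.cons_append]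
        rw [Finset.mul_sum, ← Finset.sum_add_distrib]
        refine Finset.sum_congr rfl fun k _ => ?_
        rw [fgenL_succ_cons _ _ _ b]
        ring

theorem mixpow_eq (τ : ℂ) (e : ℤ) : mixpow τ τ⁻¹ e = τ ^ e := by
  unfold mixpow
  split_ifs with h
  · rw [← zpow_natCast, Int.toNat_of_nonneg h]
  · rw [inv_pow, ← zpow_natCast, Int.toNat_of_nonneg (by omega), zpow_neg, inv_inv]

theorem coe_flatten_map {α β : Type*} (l : List α) (f : α → List β) :
    (((l.map f).flatten : List β) : Multiset β) = (l.map fun g => (f g : Multiset β)).sum := by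
  induction l with
  | nil => rfl
  | cons a l ih => simp [← ih, ← Multiset.coe_add]

theorem sum_rev_filter {n : ℕ} {α : Type*} [AddCommMonoid α] (p : Fin n → Prop) [DecidablePred p]
    (F : Fin n → α) :
    (((List.finRange n).reverse.filter (fun g => p g)).map F).sum
      = ∑ g, if p g then F g else 0 := by
  rw [List.filter_reverse, List.map_reverse, List.sum_reverse, ← Finset.sum_filter]
  rw [Finset.sum_eq_multiset_sum]
  rw [← Multiset.sum_coe, ← Multiset.map_coe]
  congr 2

theorem coe_finRange_map {m : ℕ} {R : Type*} (F : Fin m → R) :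
    (((List.finRange m).map F : List R) : Multiset R) = ∑ j, ({F j} : Multiset R) := by
  rw [← Multiset.map_coe, ← Multiset.sum_map_singleton (Multiset.map F _), Multiset.map_map]
  rfl

theorem coe_argList {R : Type*} [CommRing R] (n m : ℕ) (τ τi : R)
    (Z : Fin n → Fin m → R) (k : Fin n) :
    (argList n m τ τi Z k : Multiset R) =
      ∑ g, ∑ j, ((if k < g then {Z g j * τ} else 0) + (if g < k then {Z g j * τi} else 0)) := by
  unfold argList
  rw [← Multiset.coe_add, coe_flatten_map, coe_flatten_map, sum_rev_filter, sum_rev_filter,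
    ← Finset.sum_add_distrib]
  refine Finset.sum_congr rfl fun g _ => ?_
  rw [Finset.sum_add_distrib, coe_finRange_map, coe_finRange_map]
  congr 1 <;> split_ifs <;> simp

theorem argList_split (n m : ℕ) (τ a : ℂ) (hτ : τ ≠ 0)
    (Z : Fin (n + 1) → Fin (m + 1) → ℂ)
    (hZ : ∀ k, Z k (Fin.last m) = a * τ ^ (2 * (n + 1) - 2 * ((k : ℕ) + 1))) (k : Fin (n + 1)) :
    (argList (n + 1) (m + 1) τ τ⁻¹ Z k : Multiset ℂ) =
      (((List.finRange n).map fun i : Fin n => a * τ ^ (2 * (n - (i : ℕ)) - 1)) ++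
        argList (n + 1) m τ τ⁻¹ (fun k j => Z k j.castSucc) k : List ℂ) := by
  rw [← Multiset.coe_add, coe_argList, coe_argList, coe_finRange_map]
  simp only [Fin.sum_univ_castSucc (n := m)]
  rw [Finset.sum_add_distrib, add_comm]
  congr 1
  rw [Fin.sum_univ_succAbove _ k]
  simp only [lt_irrefl, if_false, add_zero, zero_add]
  refine Finset.sum_congr rfl fun i _ => ?_
  rw [hZ]
  have hi := i.isLt
  rcases lt_or_ge i.castSucc k with h | h
  · rw [Fin.succAbove_of_castSucc_lt _ _ h, if_neg (not_lt.mpr h.le), if_pos h, zero_add]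
    congr 1
    rw [mul_assoc]
    congr 1
    rw [Fin.val_castSucc, show 2 * (n + 1) - 2 * ((i : ℕ) + 1) = (2 * (n - (i : ℕ)) - 1) + 1 by omega,
      pow_succ, mul_assoc, mul_inv_cancel₀ hτ, mul_one]
  · have h' : k < i.succ := lt_of_le_of_lt h (Fin.castSucc_lt_succ)
    rw [Fin.succAbove_of_le_castSucc _ _ h, if_pos h', if_neg (not_lt.mpr h'.le), add_zero]
    congr 1
    rw [mul_assoc, ← pow_succ]
    congr 2
    rw [Fin.val_succ]
    omega

theorem numerA_split (n m : ℕ) (τ a : ℂ) (hτ : τ ≠ 0)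
    (Z : Fin (n + 1) → Fin (m + 1) → ℂ)
    (hZ : ∀ k, Z k (Fin.last m) = a * τ ^ (2 * (n + 1) - 2 * ((k : ℕ) + 1))) (lam : ℕ) (x : ℂ) :
    numerA (n + 1) (m + 1) τ τ⁻¹ lam x Z = (x - a * τ ^ n) * ∑ k : Fin (n + 1),
      (∏ j : Fin m, (x - Z k j.castSucc *
        mixpow τ τ⁻¹ (2 * ((k : ℕ) : ℤ) + 1 - ((n + 1 : ℕ) : ℤ)))) *
      fgenL τ τ⁻¹ (x * mixpow τ τ⁻¹ (((n + 1 : ℕ) : ℤ) - (2 * ((k : ℕ) : ℤ) + 1))) lam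
        (((List.finRange n).map fun i : Fin n => a * τ ^ (2 * (n - (i : ℕ)) - 1)) ++
        argList (n + 1) m τ τ⁻¹ (fun k j => Z k j.castSucc) k) := by
  unfold numerA
  rw [Finset.mul_sum]
  refine Finset.sum_congr rfl fun k _ => ?_
  rw [fgenL_congr _ _ _ _ _ _ (argList_split n m τ a hτ Z hZ k), Fin.prod_univ_castSucc]
  have : Z k (Fin.last m) * mixpow τ τ⁻¹ (2 * ((k : ℕ) : ℤ) + 1 - ((n + 1 : ℕ) : ℤ))
      = a * τ ^ n := by
    rw [hZ, mixpow_eq, mul_assoc]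
    congr 1
    rw [← zpow_natCast, ← zpow_natCast, ← zpow_add₀ hτ]
    congr 1
    have := k.isLt
    omega
  rw [this]
  ring

/-- determinant recursion (Proposition 5.2).  With
`M = (n-1)m - 1` and `M_{m-1} = (n-1)(m-1) - 1`, restricting to
`z_m^{(k)} = aτ^{2n-2k}` (for all `k`),
`Δ^{(m)}(x₁,…,x_M | z) = Π_μ (x_μ - aτ^{n-1}) ·
  Σ_{μ₁<⋯<μ_{n-1}} (-1)^{Σ_i (mn-m-n+i+μ_i)} det(h_α(x_{μ_i}|z'))_{i,α}
    Δ^{(m-1)}(x ∖ {x_{μ₁},…,x_{μ_{n-1}}} | z')`,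
where `h_α = A^{(m-1)}_{M_{m-1}+α}` and the `μ_i` are `1`-based. -/
theorem Delta_recursion (n m : ℕ) (hn : 2 ≤ n) (hm : 2 ≤ m)
    (q : ℂ) (hq : q ≠ 0) (a : ℂ)
    (x : Fin ((n - 1) * m - 1) → ℂ) (hx : ∀ μ, x μ ≠ 0)
    (Z : Fin n → Fin m → ℂ)
    (hZ : ∀ k : Fin n, Z k ⟨m - 1, by omega⟩ = a * (q⁻¹) ^ (2 * n - 2 * ((k : ℕ) + 1))) :
    Matrix.det (Matrix.of fun lam μ : Fin ((n - 1) * m - 1) =>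
        Afun q n m ((lam : ℕ) + 1) (x μ) Z)
      = (∏ μ, (x μ - a * (q⁻¹) ^ (n - 1))) *
        ∑ s ∈ (Finset.powersetCard (n - 1)
            (Finset.univ : Finset (Fin ((n - 1) * m - 1)))).attach,
          ((-1 : ℂ) ^ (∑ i : Fin (n - 1), (m * n - m - n + ((i : ℕ) + 1) +
              ((s.1.orderEmbOfFin (Finset.mem_powersetCard.mp s.2).2 i : ℕ) + 1)))) *
            Matrix.det (Matrix.of fun i α : Fin (n - 1) =>
              Afun q n (m - 1) ((n - 1) * (m - 1) - 1 + ((α : ℕ) + 1))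
                (x (s.1.orderEmbOfFin (Finset.mem_powersetCard.mp s.2).2 i))
                (fun k j => Z k ⟨(j : ℕ), by omega⟩)) *
            Matrix.det (Matrix.of fun lam μ : Fin ((n - 1) * (m - 1) - 1) =>
              Afun q n (m - 1) ((lam : ℕ) + 1)
                (x ((s.1ᶜ).orderEmbOfFin
                  (compl_card_aux n m s.1 (Finset.mem_powersetCard.mp s.2).2) μ))
                (fun k j => Z k ⟨(j : ℕ), by omega⟩)) := by
  obtain ⟨n, rfl⟩ : ∃ n', n = n' + 1 := ⟨n - 1, by omega⟩
  obtain ⟨m, rfl⟩ : ∃ m', m = m' + 1 := ⟨m - 1, by omega⟩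
  have hτ : q⁻¹ ≠ 0 := inv_ne_zero hq
  have hnm : 1 ≤ n * m := Nat.mul_pos (by omega) (by omega)
  have hM : (n + 1 - 1) * (m + 1) - 1 = ((n + 1 - 1) * (m + 1 - 1) - 1) + (n + 1 - 1) := by
    simp only [Nat.add_sub_cancel, Nat.mul_add, Nat.mul_one]
    omega
  have hp : (m + 1) * (n + 1) - (m + 1) - (n + 1) = (n + 1 - 1) * (m + 1 - 1) - 1 := by
    simp only [Nat.add_sub_cancel]
    have : (m + 1) * (n + 1) = n * m + m + n + 1 := by ring
    omega
  have hdet : Matrix.det (Matrix.of fun lam μ : Fin ((n + 1 - 1) * (m + 1) - 1) =>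
        Afun q (n + 1) (m + 1) ((lam : ℕ) + 1) (x μ) Z)
      = (∏ μ, (x μ - a * (q⁻¹) ^ n)) *
        Matrix.det (Matrix.of fun lam μ : Fin ((n + 1 - 1) * (m + 1) - 1) =>
        Afun q (n + 1) m ((lam : ℕ) + 1) (x μ) (fun k j => Z k j.castSucc)) := by
    have hS := fun lam x => numerA_split n m q⁻¹ a hτ Z hZ lam x
    simp only [inv_inv] at hS
    simp only [Afun, hS]
    simp only [mul_div_assoc]
    refine (Matrix.det_mul_row (fun μ => x μ - a * q⁻¹ ^ n) (Matrix.of fun lam μ =>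
      (∑ k : Fin (n + 1), (∏ j : Fin m, (x μ - Z k j.castSucc *
        mixpow q⁻¹ q (2 * ((k : ℕ) : ℤ) + 1 - ((n + 1 : ℕ) : ℤ)))) *
      fgenL q⁻¹ q (x μ * mixpow q⁻¹ q (((n + 1 : ℕ) : ℤ) - (2 * ((k : ℕ) : ℤ) + 1))) ((lam : ℕ) + 1)
        (((List.finRange n).map fun i : Fin n => a * q⁻¹ ^ (2 * (n - (i : ℕ)) - 1)) ++
        argList (n + 1) m q⁻¹ q (fun k j => Z k j.castSucc) k)) / x μ)).trans ?_
    congr 1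
    refine (congrArg Matrix.det ?_).trans ((det_append _ (n + 1) q⁻¹ q
      (fun k μ => (∏ j : Fin m, (x μ - Z k j.castSucc *
        mixpow q⁻¹ q (2 * ((k : ℕ) : ℤ) + 1 - ((n + 1 : ℕ) : ℤ)))) / x μ)
      (fun k μ => x μ * mixpow q⁻¹ q (((n + 1 : ℕ) : ℤ) - (2 * ((k : ℕ) : ℤ) + 1)))
      (fun k => argList (n + 1) m q⁻¹ q (fun k j => Z k j.castSucc) k)
      ((List.finRange n).map fun i : Fin n => a * q⁻¹ ^ (2 * (n - (i : ℕ)) - 1))).trans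
      (congrArg Matrix.det ?_))
    · ext lam μ
      simp only [Matrix.of_apply, Finset.sum_div]
      exact Finset.sum_congr rfl fun k _ => mul_div_right_comm _ _ _
    · ext lam μ
      simp only [Matrix.of_apply, numerA, Finset.sum_div]
      exact Finset.sum_congr rfl fun k _ => (mul_div_right_comm _ _ _).symm
  rw [hdet, laplace_gen _ _ _ hM _ (fun s hs => compl_card_aux (n + 1) (m + 1) s hs)]
  congr 1
  refine Finset.sum_congr rfl fun s _ => ?_
  congr 2
  rw [hp]
  rw [neg_one_pow_congr]
  have : ∀ i : Fin (n + 1 - 1), ((n + 1 - 1) * (m + 1 - 1) - 1 + ((i : ℕ) + 1) +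
              ((s.1.orderEmbOfFin (Finset.mem_powersetCard.mp s.2).2 i : ℕ) + 1)) =
      ((n + 1 - 1) * (m + 1 - 1) - 1 + (i : ℕ) +
              (s.1.orderEmbOfFin (Finset.mem_powersetCard.mp s.2).2 i : ℕ)) + 2 := by
    intro i; ring
  simp only [this]
  rw [Finset.sum_add_distrib (g := fun _ => 2), Finset.sum_const, smul_eq_mul, Nat.even_add]
  simp
end
end

section
/- Vanishing of the deformed determinant (general m, Proposition 5.5): for each k ∈ {2,…,n} and each j ∈ {1,…,m}, the restriction of Δ̃^{(m)}(x_1,…,x_M | z^{(n)}| z^{(n−1)}|…| z^{(2)} | z'^{(1)}, z_0) to z_j^{(k)} = z_0 τ^{2n−2} vanishes identically (wherever the denominators are nonzero). -/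
noncomputable section

/-- The deformed entries `Ã_λ^{(m)}(x | z^{(n)} | ⋯ | z^{(2)} | z'^{(1)}, z₀)`.
Here `Z` collects the groups `z^{(n)}, …, z^{(2)}` (as `Z (n-1), …, Z 1`) and
the `0`-th group is `(z'^{(1)}, z₀)`, the extra variable `z₀` sitting in the
last slot `Z 0 (m-1)`; `τ = q⁻¹`. -/
def Atilde (q : ℂ) (n m : ℕ) (hn : 0 < n) (hm : 0 < m) (lam : ℕ) (x : ℂ)
    (Z : Fin n → Fin m → ℂ) : ℂ :=
  (x - Z ⟨0, hn⟩ ⟨m - 1, by omega⟩ * (q⁻¹) ^ (n - 1)) /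
      (x - Z ⟨0, hn⟩ ⟨m - 1, by omega⟩ * (q⁻¹) ^ (n + 1)) *
    Afun q n m lam x (fun k j =>
      if k = (⟨0, hn⟩ : Fin n) ∧ j = (⟨m - 1, by omega⟩ : Fin m) then
        Z ⟨0, hn⟩ ⟨m - 1, by omega⟩ * (q⁻¹) ^ (2 * n)
      else Z k j)
  + (Z ⟨0, hn⟩ ⟨m - 1, by omega⟩ * (q⁻¹) ^ (n + 1) / x) *
    (q ^ 2 * (∏ p ∈ Finset.univ.filter (fun p : Fin n × Fin m =>
          ¬(p.1 = (⟨0, hn⟩ : Fin n) ∧ p.2 = (⟨m - 1, by omega⟩ : Fin m))),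
        (x * (q⁻¹) ^ (n - 1) - Z p.1 p.2) /
          (Z ⟨0, hn⟩ ⟨m - 1, by omega⟩ * (q⁻¹) ^ 2 - Z p.1 p.2))
      - (x - Z ⟨0, hn⟩ ⟨m - 1, by omega⟩ * (q⁻¹) ^ (n - 1)) /
          (x - Z ⟨0, hn⟩ ⟨m - 1, by omega⟩ * (q⁻¹) ^ (n + 1)) *
        ∏ p ∈ Finset.univ.filter (fun p : Fin n × Fin m =>
          ¬(p.1 = (⟨0, hn⟩ : Fin n) ∧ p.2 = (⟨m - 1, by omega⟩ : Fin m))),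
          (x * q ^ (n - 1) - Z p.1 p.2) /
            (Z ⟨0, hn⟩ ⟨m - 1, by omega⟩ * (q⁻¹) ^ 2 - Z p.1 p.2)) *
    Afun q n m lam (Z ⟨0, hn⟩ ⟨m - 1, by omega⟩ * (q⁻¹) ^ (n + 1)) (fun k j =>
      if k = (⟨0, hn⟩ : Fin n) ∧ j = (⟨m - 1, by omega⟩ : Fin m) then
        Z ⟨0, hn⟩ ⟨m - 1, by omega⟩ * (q⁻¹) ^ (2 * n)
      else Z k j)

open Finset in
lemma T_aux (c : ℕ → ℂ) (w a : ℂ) (M : ℕ) :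
    (w - a) * ∑ lam ∈ range (M + 1), w ^ (M - lam) * ∑ κ ∈ range (lam + 1), c κ * a ^ (lam - κ)
      = (∑ κ ∈ range (M + 2), c κ * w ^ (M + 1 - κ))
        - ∑ κ ∈ range (M + 2), c κ * a ^ (M + 1 - κ) := by
  have hE : ∀ (L : ℕ) (u : ℂ), ∑ κ ∈ range (L + 2), c κ * u ^ (L + 1 - κ)
      = u * ∑ κ ∈ range (L + 1), c κ * u ^ (L - κ) + c (L + 1) := by
    intro L u
    rw [sum_range_succ, mul_sum]
    congr 1
    · refine sum_congr rfl fun κ hκ => ?_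
      have : L + 1 - κ = (L - κ) + 1 := by have := mem_range.1 hκ; omega
      rw [this, pow_succ]; ring
    · simp
  induction M with
  | zero => simp [hE, sum_range_succ]; ring
  | succ M ih =>
    rw [sum_range_succ, hE (M + 1) w, hE (M + 1) a]
    have : ∑ lam ∈ range (M + 1), w ^ (M + 1 - lam) * ∑ κ ∈ range (lam + 1), c κ * a ^ (lam - κ)
       = w * ∑ lam ∈ range (M + 1), w ^ (M - lam) * ∑ κ ∈ range (lam + 1), c κ * a ^ (lam - κ) := by
      rw [mul_sum]
      refine sum_congr rfl fun κ hκ => ?_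
      have : M + 1 - κ = (M - κ) + 1 := by have := mem_range.1 hκ; omega
      rw [this, pow_succ]; ring
    rw [this]
    simp only [Nat.sub_self, pow_zero, one_mul]
    linear_combination w * ih

lemma esym_prod (l : List ℂ) (u : ℂ) :
    (l.map (fun z => u - z)).prod
      = ∑ κ ∈ Finset.range (l.length + 1), ((-1) ^ κ * esymL l κ) * u ^ (l.length - κ) := by
  have h := congrArg (Polynomial.eval u) (Multiset.prod_X_sub_X_eq_sum_esymm (l : Multiset ℂ))
  rw [Polynomial.eval_multiset_prod, Polynomial.eval_finsetSum] at h
  simp only [Multiset.map_coe, List.map_map, Multiset.prod_coe, Multiset.coe_card] at h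
  convert h using 1
  · simp [Function.comp_def]
  · refine Finset.sum_congr rfl fun κ _ => ?_
    simp [esymL, Multiset.esymm, Multiset.powersetCard_coe, Function.comp_def, mul_assoc]

open Finset in
lemma fgen_sum (M : ℕ) (t ti y w : ℂ) (l : List ℂ) (hl : l.length = M + 1)
    (ha : w - y * t ≠ 0) (hb : w - y * ti ≠ 0)
    (hw : (l.map (fun z => w - z)).prod = 0) :
    ∑ i : Fin M, w ^ (M - 1 - (i : ℕ)) * fgenL t ti y ((i : ℕ) + 1) l
      = (l.map (fun z => y * ti - z)).prod / (w - y * ti)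
        - (l.map (fun z => y * t - z)).prod / (w - y * t) := by
  have key := fun a => T_aux (fun κ => (-1) ^ κ * esymL l κ) w a M
  have e : ∀ u : ℂ, ∑ κ ∈ range (M + 2), ((-1) ^ κ * esymL l κ) * u ^ (M + 1 - κ)
      = (l.map (fun z => u - z)).prod := by
    intro u; rw [esym_prod, hl]
  simp only [e, hw] at key
  have h1 : ∑ i : Fin M, w ^ (M - 1 - (i : ℕ)) * fgenL t ti y ((i : ℕ) + 1) l
      = ∑ lam ∈ range (M + 1), w ^ (M - lam) * fgenL t ti y lam l := by
    rw [sum_range_succ', Fin.sum_univ_eq_sum_range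
      (fun i => w ^ (M - 1 - i) * fgenL t ti y (i + 1) l)]
    simp [fgenL, Nat.sub_sub, add_comm]
  have h2 : ∀ lam, fgenL t ti y lam l
      = (∑ κ ∈ range (lam + 1), ((-1) ^ κ * esymL l κ) * (y * t) ^ (lam - κ))
       - ∑ κ ∈ range (lam + 1), ((-1) ^ κ * esymL l κ) * (y * ti) ^ (lam - κ) := by
    intro lam
    rw [sum_range_succ, sum_range_succ, fgenL]
    simp only [Nat.sub_self, pow_zero]
    rw [add_sub_add_right_eq_sub, ← sum_sub_distrib]
    refine sum_congr rfl fun κ _ => by ring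
  rw [h1]
  simp only [h2, mul_sub, sum_sub_distrib]
  have ka := key (y * t)
  have kb := key (y * ti)
  rw [mul_comm, ← eq_div_iff ha] at ka
  rw [mul_comm, ← eq_div_iff hb] at kb
  rw [ka, kb]
  ring

open Finset in
lemma argList_prod (n m : ℕ) (t ti u : ℂ) (Z : Fin n → Fin m → ℂ) (k : Fin n) :
    ((argList n m t ti Z k).map (fun z => u - z)).prod
      = (∏ g ∈ univ.filter (fun g => k < g), ∏ j, (u - Z g j * t))
        * ∏ g ∈ univ.filter (fun g => g < k), ∏ j, (u - Z g j * ti) := by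
  have h : ∀ (p : Fin n → Prop) [DecidablePred p] (s : ℂ),
      (((((List.finRange n).reverse.filter (fun g => p g)).map
      (fun g => (List.finRange m).map (fun j => Z g j * s))).flatten).map (fun z => u - z)).prod
      = ∏ g ∈ univ.filter p, ∏ j, (u - Z g j * s) := by
    intro p _ s
    rw [List.map_flatten, List.prod_flatten, List.map_map, List.map_map]
    rw [← List.prod_toFinset]
    · refine prod_congr ?_ fun g _ => ?_
      · ext g; simp
      · simp only [Function.comp, List.map_map]
        rw [← List.prod_toFinset _ (List.nodup_finRange m)]
        simp
    · exact (List.nodup_reverse.2 (List.nodup_finRange n)).filter _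
  rw [argList, List.map_append, List.prod_append, h, h]

lemma argList_length (n m : ℕ) (t ti : ℂ) (Z : Fin n → Fin m → ℂ) (k : Fin n) :
    (argList n m t ti Z k).length = (n - 1) * m := by
  have h : ∀ (p : Fin n → Prop) [DecidablePred p],
      ((List.finRange n).reverse.filter (fun g => p g)).length
      = (Finset.univ.filter p).card := by
    intro p _
    rw [← List.toFinset_card_of_nodup
      ((List.nodup_reverse.2 (List.nodup_finRange n)).filter _)]
    congr 1
    ext g; simp
  rw [argList]
  simp only [List.length_append, List.length_flatten, List.map_map, Function.comp_def,
    List.length_map, List.length_finRange, List.map_const', List.sum_replicate, smul_eq_mul, h]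
  rw [← add_mul]
  congr 1
  have h1 : Finset.univ.filter (fun g => k < g) = Finset.Ioi k := by ext; simp
  have h2 : Finset.univ.filter (fun g => g < k) = Finset.Iio k := by ext; simp
  rw [h1, h2, Fin.card_Ioi, Fin.card_Iio]
  have := k.2
  omega

lemma mixpow_eq_s18 (t : ℂ) (a : ℤ) : mixpow t t⁻¹ a = t ^ a := by
  unfold mixpow
  split_ifs with h
  · rw [← zpow_natCast, Int.toNat_of_nonneg h]
  · rw [inv_pow, ← zpow_natCast, Int.toNat_of_nonneg (by omega), ← zpow_neg, neg_neg]

/-- the telescoping quantity -/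
def Vt (n m : ℕ) (t x : ℂ) (Z : Fin n → Fin m → ℂ) (i : ℕ) : ℂ :=
  ∏ g : Fin n, ∏ j, (x * t ^ ((n : ℤ) - 2 * i) - Z g j * (if (g : ℕ) < i then t⁻¹ else t))

open Finset in
lemma split1 (n : ℕ) (F G : Fin n → ℂ) (k : Fin n) :
    F k * ((∏ g ∈ univ.filter (fun g => k < g), F g) * ∏ g ∈ univ.filter (fun g => g < k), G g)
      = ∏ g : Fin n, if (g : ℕ) < k then G g else F g := by
  rw [prod_ite]
  have : univ.filter (fun g : Fin n => ¬ (g : ℕ) < k)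
     = insert k (univ.filter (fun g => k < g)) := by
    ext g; simp only [mem_filter, mem_univ, true_and, mem_insert, Fin.ext_iff, Fin.lt_def]; omega
  rw [this, prod_insert (by simp)]
  simp only [Fin.lt_def]; ring

open Finset in
lemma split2 (n : ℕ) (F G : Fin n → ℂ) (k : Fin n) :
    G k * ((∏ g ∈ univ.filter (fun g => k < g), F g) * ∏ g ∈ univ.filter (fun g => g < k), G g)
      = ∏ g : Fin n, if (g : ℕ) < k + 1 then G g else F g := by
  rw [prod_ite]
  have : univ.filter (fun g : Fin n => (g : ℕ) < k + 1)
     = insert k (univ.filter (fun g => g < k)) := by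
    ext g; simp only [mem_filter, mem_univ, true_and, mem_insert, Fin.ext_iff, Fin.lt_def]; omega
  rw [this, prod_insert (by simp)]
  have : univ.filter (fun g : Fin n => ¬ (g : ℕ) < k + 1) = (univ.filter (fun g => k < g)) := by
    ext g; simp only [mem_filter, mem_univ, true_and, Fin.lt_def]; omega
  rw [this]; ring

open Finset in
lemma numer_sum (n m M : ℕ) (t w x : ℂ) (ht : t ≠ 0) (Z : Fin n → Fin m → ℂ)
    (hM : (n - 1) * m = M + 1)
    (hgen : ∀ i : ℕ, i ≤ n → w - x * t ^ ((n : ℤ) - 2 * i) ≠ 0)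
    (hw : ∀ k, ((argList n m t t⁻¹ Z k).map (fun z => w - z)).prod = 0) :
    ∑ i : Fin M, w ^ (M - 1 - (i : ℕ)) * numerA n m t t⁻¹ ((i : ℕ) + 1) x Z
      = (∏ g, ∏ j, (x * t ^ (1 - (n : ℤ)) - Z g j)) / (w - x * t ^ (-(n : ℤ)))
       - (∏ g, ∏ j, (x * t ^ ((n : ℤ) - 1) - Z g j)) / (w - x * t ^ (n : ℤ)) := by
  set U : ℕ → ℂ := fun i => (t ^ (2 * (i : ℤ) - n)) ^ m * Vt n m t x Z i
    / (w - x * t ^ ((n : ℤ) - 2 * i)) with hU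
  have hterm : ∀ k : Fin n, (∏ j : Fin m, (x - Z k j * t ^ (2 * ((k : ℕ) : ℤ) + 1 - (n : ℤ)))) *
      ∑ i : Fin M, w ^ (M - 1 - (i : ℕ)) *
        fgenL t t⁻¹ (x * t ^ ((n : ℤ) - (2 * ((k : ℕ) : ℤ) + 1))) ((i : ℕ) + 1)
          (argList n m t t⁻¹ Z k) = U (k + 1) - U k := by
    intro k
    have ea : x * t ^ ((n : ℤ) - (2 * ((k : ℕ) : ℤ) + 1)) * t = x * t ^ ((n : ℤ) - 2 * (k : ℕ)) := by
      rw [mul_assoc, ← zpow_add_one₀ ht]; congr 2; ring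
    have eb : x * t ^ ((n : ℤ) - (2 * ((k : ℕ) : ℤ) + 1)) * t⁻¹
        = x * t ^ ((n : ℤ) - 2 * ((k + 1 : ℕ) : ℤ)) := by
      rw [mul_assoc, ← zpow_sub_one₀ ht]; congr 2; push_cast; ring
    rw [fgen_sum M _ _ _ _ _ ((argList_length n m _ _ Z k).trans hM)
      (by rw [ea]; exact hgen _ (by have := k.2; omega))
      (by rw [eb]; exact hgen _ (by have := k.2; omega)) (hw k), ea, eb, mul_sub,
      argList_prod, argList_prod]
    congr 1
    · rw [← mul_div_assoc, hU]
      congr 1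
      have : (∏ j : Fin m, (x - Z k j * t ^ (2 * ((k : ℕ) : ℤ) + 1 - (n : ℤ))))
        = (t ^ (2 * ((k + 1 : ℕ) : ℤ) - n)) ^ m *
          ∏ j, (x * t ^ ((n : ℤ) - 2 * ((k + 1 : ℕ) : ℤ)) - Z k j * t⁻¹) := by
        rw [← Fin.prod_const, ← prod_mul_distrib]
        refine prod_congr rfl fun j _ => ?_
        have h1 : t ^ (2 * ((k + 1 : ℕ) : ℤ) - n) * t ^ ((n : ℤ) - 2 * ((k + 1 : ℕ) : ℤ)) = 1 := by
          rw [← zpow_add₀ ht]; simp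
        have h2 : t ^ (2 * ((k + 1 : ℕ) : ℤ) - n) * t⁻¹ = t ^ (2 * ((k : ℕ) : ℤ) + 1 - (n : ℤ)) := by
          rw [← zpow_sub_one₀ ht]; congr 1; push_cast; ring
        linear_combination -x * h1 + Z k j * h2
      rw [this, mul_assoc, Vt]
      congr 1
      have := split2 n (fun g => ∏ j, (x * t ^ ((n : ℤ) - 2 * ((k + 1 : ℕ) : ℤ)) - Z g j * t))
        (fun g => ∏ j, (x * t ^ ((n : ℤ) - 2 * ((k + 1 : ℕ) : ℤ)) - Z g j * t⁻¹)) k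
      rw [this]
      refine prod_congr rfl fun g _ => ?_
      split_ifs <;> rfl
    · rw [← mul_div_assoc, hU]
      congr 1
      have : (∏ j : Fin m, (x - Z k j * t ^ (2 * ((k : ℕ) : ℤ) + 1 - (n : ℤ))))
        = (t ^ (2 * ((k : ℕ) : ℤ) - n)) ^ m *
          ∏ j, (x * t ^ ((n : ℤ) - 2 * ((k : ℕ) : ℤ)) - Z k j * t) := by
        rw [← Fin.prod_const, ← prod_mul_distrib]
        refine prod_congr rfl fun j _ => ?_
        have h1 : t ^ (2 * ((k : ℕ) : ℤ) - n) * t ^ ((n : ℤ) - 2 * ((k : ℕ) : ℤ)) = 1 := by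
          rw [← zpow_add₀ ht]; simp
        have h2 : t ^ (2 * ((k : ℕ) : ℤ) - n) * t = t ^ (2 * ((k : ℕ) : ℤ) + 1 - (n : ℤ)) := by
          rw [← zpow_add_one₀ ht]; congr 1; ring
        linear_combination -x * h1 + Z k j * h2
      rw [this, mul_assoc, Vt]
      congr 1
      have := split1 n (fun g => ∏ j, (x * t ^ ((n : ℤ) - 2 * ((k : ℕ) : ℤ)) - Z g j * t))
        (fun g => ∏ j, (x * t ^ ((n : ℤ) - 2 * ((k : ℕ) : ℤ)) - Z g j * t⁻¹)) k
      rw [this]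
      refine prod_congr rfl fun g _ => ?_
      split_ifs <;> rfl
  have hsum : ∑ i : Fin M, w ^ (M - 1 - (i : ℕ)) * numerA n m t t⁻¹ ((i : ℕ) + 1) x Z
      = ∑ k : Fin n, (U (k + 1) - U k) := by
    simp only [← hterm, numerA, mixpow_eq_s18, mul_sum]
    rw [sum_comm]
    refine sum_congr rfl fun k _ => sum_congr rfl fun i _ => by ring
  rw [hsum, Fin.sum_univ_eq_sum_range (fun i => U (i + 1) - U i), sum_range_sub]
  have pull : ∀ (y s : ℂ) , (s ^ (n : ℤ)) ^ m * ∏ g : Fin n, ∏ j : Fin m, (y - Z g j * s⁻¹)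
      = ∏ g : Fin n, ∏ j : Fin m, (s * (y - Z g j * s⁻¹)) := by
    intro y s
    simp only [prod_mul_distrib, prod_const, card_univ, Fintype.card_fin]
    rw [zpow_natCast, ← pow_mul, ← pow_mul, mul_comm n m]
  congr 1
  · simp only [hU, Vt]
    have e1 : (2 * (n : ℤ) - n) = n := by ring
    have e2 : ((n : ℤ) - 2 * n) = -n := by ring
    rw [e1, e2]
    congr 1
    simp only [Fin.is_lt, if_true]
    rw [pull]
    refine prod_congr rfl fun g _ => prod_congr rfl fun j _ => ?_
    have : t ^ (1 - (n : ℤ)) = t * t ^ (-(n : ℤ)) := by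
      rw [sub_eq_add_neg, zpow_add₀ ht, zpow_one]
    rw [this]; field_simp
  · simp only [hU, Vt]
    simp only [Nat.cast_zero, mul_zero, zero_sub, sub_zero, not_lt_zero, if_false]
    congr 1
    have := pull (x * t ^ (n : ℤ)) t⁻¹
    rw [inv_zpow', inv_inv] at this
    rw [this]
    refine prod_congr rfl fun g _ => prod_congr rfl fun j _ => ?_
    rw [zpow_sub_one₀ ht]; field_simp

open Finset in
lemma prod_split (n m : ℕ) (a : Fin n) (b : Fin m) (F : Fin n → Fin m → ℂ) :
    ∏ g, ∏ j, F g j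
      = (∏ p ∈ univ.filter (fun p : Fin n × Fin m => ¬(p.1 = a ∧ p.2 = b)), F p.1 p.2)
        * F a b := by
  rw [← Fintype.prod_prod_type' , ← prod_filter_mul_prod_filter_not univ
    (fun p : Fin n × Fin m => ¬(p.1 = a ∧ p.2 = b))]
  congr 1
  have : univ.filter (fun p : Fin n × Fin m => ¬ ¬(p.1 = a ∧ p.2 = b)) = {(a, b)} := by
    ext p; simp [Prod.ext_iff]
  rw [this, prod_singleton]

lemma numer_cont (n m : ℕ) (t ti : ℂ) (lam : ℕ) (Z : Fin n → Fin m → ℂ) :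
    Continuous (fun x => numerA n m t ti lam x Z) := by
  unfold numerA fgenL
  fun_prop

open Finset in
lemma R_eq (n m M : ℕ) (t z0 x : ℂ) (ht : t ≠ 0) (Z : Fin n → Fin m → ℂ)
    (hM : (n - 1) * m = M + 1) (a k : Fin n) (b j : Fin m) (ha : (a : ℕ) = 0)
    (hk : 1 ≤ (k : ℕ)) (hab : Z a b = z0 * t ^ (2 * n)) (hkj : Z k j = z0 * t ^ (2 * n - 2)) :
    (z0 * t ^ (2 * n - 1) - x * t ^ n) *
      ∑ i : Fin M, (z0 * t ^ (2 * n - 1)) ^ (M - 1 - (i : ℕ)) *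
        numerA n m t t⁻¹ ((i : ℕ) + 1) x Z
      = -t * (∏ p ∈ univ.filter (fun p : Fin n × Fin m => ¬(p.1 = a ∧ p.2 = b)),
            (x * t⁻¹ ^ (n - 1) - Z p.1 p.2)) * (z0 * t ^ (2 * n - 1) - x * t ^ n)
        - (∏ p ∈ univ.filter (fun p : Fin n × Fin m => ¬(p.1 = a ∧ p.2 = b)),
            (x * t ^ (n - 1) - Z p.1 p.2)) * (x * t ^ (n - 1) - z0 * t ^ (2 * n)) := by
  have hn : 1 ≤ n := by have := k.2; omega
  set w := z0 * t ^ (2 * n - 1) with hwdef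
  have hw1 : w = Z a b * t⁻¹ := by
    rw [hab, hwdef, mul_assoc]; congr 1
    obtain ⟨c, rfl⟩ : ∃ c, n = c + 1 := ⟨n - 1, by omega⟩
    rw [show 2 * (c + 1) - 1 = 2 * c + 1 by omega, show 2 * (c + 1) = (2 * c + 1) + 1 by omega,
      pow_succ t (2 * c + 1)]
    field_simp
  have hw2 : w = Z k j * t := by
    rw [hkj, hwdef, mul_assoc, ← pow_succ]; congr 2
    omega
  have hwv : ∀ kk, ((argList n m t t⁻¹ Z kk).map (fun z => w - z)).prod = 0 := by
    intro kk
    rw [argList_prod]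
    by_cases h : a < kk
    · apply mul_eq_zero_of_right
      refine prod_eq_zero (i := a) (by simpa using h) ?_
      refine prod_eq_zero (i := b) (mem_univ _) ?_
      rw [hw1, sub_self]
    · apply mul_eq_zero_of_left
      refine prod_eq_zero (i := k) ?_ ?_
      · simp only [mem_filter, mem_univ, true_and]
        rw [Fin.lt_def] at h ⊢
        omega
      refine prod_eq_zero (i := j) (mem_univ _) ?_
      rw [hw2, sub_self]
  let bad : Set ℂ := ⋃ i ∈ (Finset.range (n + 1)), {w * (t ^ ((n : ℤ) - 2 * (i : ℕ)))⁻¹}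
  have hbad : bad.Finite := by
    apply Set.Finite.biUnion (Finset.finite_toSet _)
    intro i _; exact Set.finite_singleton _
  have hdense : Dense badᶜ := hbad.countable.dense_compl ℝ
  refine congrFun (Continuous.ext_on hdense (f := fun x => (w - x * t ^ n) *
      ∑ i : Fin M, w ^ (M - 1 - (i : ℕ)) *
        numerA n m t t⁻¹ ((i : ℕ) + 1) x Z)
      (g := fun x => -t * (∏ p ∈ univ.filter (fun p : Fin n × Fin m => ¬(p.1 = a ∧ p.2 = b)),
            (x * t⁻¹ ^ (n - 1) - Z p.1 p.2)) * (w - x * t ^ n)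
        - (∏ p ∈ univ.filter (fun p : Fin n × Fin m => ¬(p.1 = a ∧ p.2 = b)),
            (x * t ^ (n - 1) - Z p.1 p.2)) * (x * t ^ (n - 1) - z0 * t ^ (2 * n))) ?_ ?_ ?_) x
  · have := fun lam => numer_cont n m t t⁻¹ lam Z
    fun_prop
  · fun_prop
  · intro y hy
    have hgen : ∀ i : ℕ, i ≤ n → w - y * t ^ ((n : ℤ) - 2 * i) ≠ 0 := by
      intro i hi h0
      apply hy
      simp only [bad, Set.mem_iUnion, Set.mem_singleton_iff]
      refine ⟨i, by simpa [Nat.lt_succ_iff] using hi, ?_⟩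
      rw [sub_eq_zero.1 h0, mul_assoc, mul_inv_cancel₀ (zpow_ne_zero _ ht), mul_one]
    simp only
    rw [numer_sum n m M t w y ht Z hM hgen hwv, prod_split n m a b, prod_split n m a b, hab]
    have d0 := hgen 0 (by omega)
    have dn := hgen n le_rfl
    rw [show ((n : ℤ) - 2 * (0 : ℕ)) = n by simp] at d0
    rw [show ((n : ℤ) - 2 * (n : ℕ)) = -n by ring] at dn
    have e1 : t ^ (1 - (n : ℤ)) = t⁻¹ ^ (n - 1) := by
      rw [inv_pow, ← zpow_natCast, ← zpow_neg]; congr 1; push_cast [hn]; ring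
    have e2 : t ^ ((n : ℤ) - 1) = t ^ (n - 1) := by
      rw [← zpow_natCast]; congr 1; push_cast [hn]; ring
    have e3 : y * t ^ (1 - (n : ℤ)) - z0 * t ^ (2 * n) = -t * (w - y * t ^ (-(n : ℤ))) := by
      have h1 : t ^ (1 - (n : ℤ)) = t * t ^ (-(n : ℤ)) := by
        rw [sub_eq_add_neg, zpow_add₀ ht, zpow_one]
      have h2 : t ^ (2 * n) = t ^ (2 * n - 1) * t := by
        rw [← pow_succ]; congr 1; omega
      rw [h1, h2, hwdef]; ring
    rw [e3, e1, e2]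
    rw [zpow_natCast] at d0 ⊢
    field_simp

/-- vanishing of the deformed determinant (general `m`,
Proposition 5.5): for each `k ∈ {2,…,n}` (here the group `Z (k-1)`, `k ≥ 1`)
and each `j ∈ {1,…,m}`, the restriction of
`Δ̃^{(m)}(x₁,…,x_M | z^{(n)} | ⋯ | z^{(2)} | z'^{(1)}, z₀)` to
`z_j^{(k)} = z₀ τ^{2n-2}` vanishes (wherever the denominators are nonzero). -/
theorem Dtilde_vanishing (n m : ℕ) (hn : 2 ≤ n) (hm : 1 ≤ m)
    (q : ℂ) (hq : q ≠ 0)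
    (Z : Fin n → Fin m → ℂ) (x : Fin ((n - 1) * m - 1) → ℂ)
    (k : Fin n) (hk : 1 ≤ (k : ℕ)) (j : Fin m)
    (hres : Z k j = Z ⟨0, by omega⟩ ⟨m - 1, by omega⟩ * (q⁻¹) ^ (2 * n - 2))
    (hx : ∀ μ, x μ ≠ 0 ∧ x μ - Z ⟨0, by omega⟩ ⟨m - 1, by omega⟩ * (q⁻¹) ^ (n + 1) ≠ 0)
    (hz0 : Z ⟨0, by omega⟩ ⟨m - 1, by omega⟩ ≠ 0)
    (hden : ∀ p : Fin n × Fin m,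
      ¬(p.1 = (⟨0, by omega⟩ : Fin n) ∧ p.2 = (⟨m - 1, by omega⟩ : Fin m)) →
      Z ⟨0, by omega⟩ ⟨m - 1, by omega⟩ * (q⁻¹) ^ 2 - Z p.1 p.2 ≠ 0) :
    Matrix.det (Matrix.of fun lam μ : Fin ((n - 1) * m - 1) =>
        Atilde q n m (by omega) (by omega) ((lam : ℕ) + 1) (x μ) Z) = 0 := by
  have hn0 : 0 < n := by omega
  have hm0 : 0 < m := by omega
  set a : Fin n := ⟨0, by omega⟩ with hadef
  set b : Fin m := ⟨m - 1, by omega⟩ with hbdef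
  set z0 := Z a b with hz0def
  obtain ⟨t, rfl⟩ : ∃ t, q = t⁻¹ := ⟨q⁻¹, by simp⟩
  have ht : t ≠ 0 := by rintro rfl; simp at hq
  simp only [inv_inv] at *
  have hka : k ≠ a := by
    intro h; rw [h] at hk; simp [hadef] at hk
  have hkden := hden (k, j) (fun h => hka h.1)
  simp only [hres] at hkden
  have hn3 : 3 ≤ n := by
    by_contra h
    have : n = 2 := by omega
    subst this
    simp at hkden
  have ht2 : t ^ 2 ≠ 1 := by
    intro h
    apply hkden
    rw [show 2 * n - 2 = 2 * (n - 1) by omega, pow_mul, h]; simp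
  obtain ⟨M, hM⟩ : ∃ M, (n - 1) * m = M + 1 + 1 := by
    have : 2 * 1 ≤ (n - 1) * m := Nat.mul_le_mul (by omega) hm
    exact ⟨(n - 1) * m - 2, by omega⟩
  have hM' : (n - 1) * m - 1 = M + 1 := by omega
  set Zs : Fin n → Fin m → ℂ := fun k j => if k = a ∧ j = b then z0 * t ^ (2 * n) else Z k j
    with hZs
  set w := z0 * t ^ (2 * n - 1) with hwdef
  rw [← Matrix.exists_vecMul_eq_zero_iff]
  refine ⟨fun i => w ^ (((n - 1) * m - 1) - 1 - (i : ℕ)), ?_, ?_⟩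
  · intro h
    have := congrFun h ⟨((n - 1) * m - 1) - 1, by omega⟩
    simp at this
  funext μ
  obtain ⟨hx0, hxd⟩ := hx μ
  set y := x μ with hy
  set x0 := z0 * t ^ (n + 1) with hx0def
  have hx00 : x0 ≠ 0 := mul_ne_zero hz0 (pow_ne_zero _ ht)
  have hab : Zs a b = z0 * t ^ (2 * n) := by simp [hZs]
  have hkj : Zs k j = z0 * t ^ (2 * n - 2) := by simp [hZs, hka, hres]
  have hR := fun x => R_eq n m ((n - 1) * m - 1) t z0 x ht Zs (by omega) a k b j rfl hk hab hkj
  have hPs : ∀ u : ℂ, (∏ p ∈ Finset.univ.filter (fun p : Fin n × Fin m => ¬(p.1 = a ∧ p.2 = b)),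
            (u - Zs p.1 p.2))
      = ∏ p ∈ Finset.univ.filter (fun p : Fin n × Fin m => ¬(p.1 = a ∧ p.2 = b)),
            (u - Z p.1 p.2) := by
    intro u
    refine Finset.prod_congr rfl fun p hp => ?_
    have := (Finset.mem_filter.1 hp).2
    simp only [hZs, if_neg this]
  simp only [hPs] at hR
  set P : ℂ → ℂ := fun u =>
    ∏ p ∈ Finset.univ.filter (fun p : Fin n × Fin m => ¬(p.1 = a ∧ p.2 = b)), (u - Z p.1 p.2)
    with hP
  have hR' : ∀ x, (w - x * t ^ n) * ∑ i : Fin ((n - 1) * m - 1), w ^ (((n - 1) * m - 1) - 1 - (i : ℕ)) *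
        numerA n m t t⁻¹ ((i : ℕ) + 1) x Zs
      = -t * P (x * t⁻¹ ^ (n - 1)) * (w - x * t ^ n)
        - P (x * t ^ (n - 1)) * (x * t ^ (n - 1) - z0 * t ^ (2 * n)) := hR
  have hPne : P (z0 * t ^ 2) ≠ 0 :=
    Finset.prod_ne_zero_iff.2 fun p hp => hden p (Finset.mem_filter.1 hp).2
  have hent : ∀ i : Fin ((n - 1) * m - 1), Atilde t⁻¹ n m hn0 hm0 ((i : ℕ) + 1) y Z
      = (y - z0 * t ^ (n - 1)) / (y - x0) * (numerA n m t t⁻¹ ((i : ℕ) + 1) y Zs / y)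
       + (x0 / y) * (t⁻¹ ^ 2 * (P (y * t ^ (n - 1)) / P (z0 * t ^ 2))
          - (y - z0 * t ^ (n - 1)) / (y - x0) * (P (y * t⁻¹ ^ (n - 1)) / P (z0 * t ^ 2)))
         * (numerA n m t t⁻¹ ((i : ℕ) + 1) x0 Zs / x0) := by
    intro i
    simp only [Atilde, Afun, inv_inv, Finset.prod_div_distrib, hP]
    rfl
  simp only [Matrix.vecMul, dotProduct, Matrix.of_apply, Pi.zero_apply]
  set S : ℂ → ℂ := fun x => ∑ i : Fin ((n - 1) * m - 1), w ^ (((n - 1) * m - 1) - 1 - (i : ℕ)) *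
        numerA n m t t⁻¹ ((i : ℕ) + 1) x Zs with hS
  have hsum : ∑ i : Fin ((n - 1) * m - 1), w ^ (((n - 1) * m - 1) - 1 - (i : ℕ)) * Atilde t⁻¹ n m hn0 hm0 ((i : ℕ) + 1) y Z
      = (y - z0 * t ^ (n - 1)) / (y - x0) / y * S y
       + (x0 / y) * (t⁻¹ ^ 2 * (P (y * t ^ (n - 1)) / P (z0 * t ^ 2))
          - (y - z0 * t ^ (n - 1)) / (y - x0) * (P (y * t⁻¹ ^ (n - 1)) / P (z0 * t ^ 2)))
         / x0 * S x0 := by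
    simp only [hS, Finset.mul_sum]
    rw [← Finset.sum_add_distrib]
    refine Finset.sum_congr rfl fun i _ => ?_
    rw [hent]; ring
  refine hsum.trans ?_
  have hRy := hR' y
  have hRx := hR' x0
  change _ * S y = _ at hRy
  change _ * S x0 = _ at hRx
  obtain ⟨c, rfl⟩ : ∃ c, n = c + 1 := ⟨n - 1, by omega⟩
  have ew : w = z0 * t ^ (2 * c + 1) := by rw [hwdef]; congr 2
  have hc : c + 1 - 1 = c := rfl
  have e0 : x0 * t ^ (c + 1 - 1) = z0 * t ^ (2 * (c + 1)) := by
    rw [hx0def, hc]; ring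
  have e1 : x0 * t⁻¹ ^ (c + 1 - 1) = z0 * t ^ 2 := by
    rw [hx0def, hc, inv_pow, pow_add, pow_add]; field_simp
  rw [e0, e1, sub_self, mul_zero, sub_zero] at hRx
  have hne : w - x0 * t ^ (c + 1) ≠ 0 := by
    have : w - x0 * t ^ (c + 1) = z0 * t ^ (2 * c + 1) * (1 - t ^ 2) := by
      rw [ew, hx0def]; ring
    rw [this]
    exact mul_ne_zero (mul_ne_zero hz0 (pow_ne_zero _ ht)) (sub_ne_zero.2 (Ne.symm ht2))
  have hSx0 : S x0 = -t * P (z0 * t ^ 2) := by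
    apply mul_left_cancel₀ hne
    rw [hRx]; ring
  have hSy : (y - z0 * t ^ (c + 1 - 1)) * S y * t
      = -t ^ 2 * P (y * t⁻¹ ^ (c + 1 - 1)) * (y - z0 * t ^ (c + 1 - 1))
        + P (y * t ^ (c + 1 - 1)) * (y - x0) := by
    have htc : t ^ c ≠ 0 := pow_ne_zero _ ht
    apply mul_left_cancel₀ htc
    have f1 : w - y * t ^ (c + 1) = -(t ^ c * t) * (y - z0 * t ^ (c + 1 - 1)) := by
      rw [ew, hc]; ring
    have f2 : y * t ^ (c + 1 - 1) - z0 * t ^ (2 * (c + 1)) = t ^ c * (y - x0) := by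
      rw [hx0def, hc]; ring
    rw [f1, f2] at hRy
    linear_combination -hRy
  rw [hSx0]
  generalize P (y * t⁻¹ ^ (c + 1 - 1)) = Pm at hSy ⊢
  generalize P (y * t ^ (c + 1 - 1)) = Pp at hSy ⊢
  field_simp
  linear_combination hSy
end
end
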